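/- Let T be a locally satisfiable negative local theory and κ a cardinal. For every local model N of T there is a homomorphism h: N → M to a κ-ultrahomogeneous local positively closed model M of T. -/

import Mathlib

noncomputable section

structure LocalLanguage : Type 1 where
  Sorts : Type
  Rel : (n : ℕ) → (Fin n → Sorts) → Type
  Const : Sorts → Type
  Loc : Sorts → Type
  locToRel : {s : Sorts} → Loc s → Rel 2 ![s, s]
  dd0 : (s : Sorts) → Loc s
  locMul : {s : Sorts} → Loc s → Loc s → Loc s
  locLe : {s : Sorts} → Loc s → Loc s → Prop
  locMul_assoc : ∀ {s} (d₁ d₂ d₃ : Loc s), locMul (locMul d₁ d₂) d₃ = locMul d₁ (locMul d₂ d₃)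
  dd0_locMul : ∀ {s} (d : Loc s), locMul (dd0 s) d = d
  locMul_dd0 : ∀ {s} (d : Loc s), locMul d (dd0 s) = d
  locLe_refl : ∀ {s} (d : Loc s), locLe d d
  locLe_trans : ∀ {s} (d₁ d₂ d₃ : Loc s), locLe d₁ d₂ → locLe d₂ d₃ → locLe d₁ d₃
  locLe_antisymm : ∀ {s} (d₁ d₂ : Loc s), locLe d₁ d₂ → locLe d₂ d₁ → d₁ = d₂
  dd0_locLe : ∀ {s} (d : Loc s), locLe (dd0 s) d
  locMul_mono : ∀ {s} (d₁ d₂ e₁ e₂ : Loc s), locLe d₁ e₁ → locLe d₂ e₂ →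
    locLe (locMul d₁ d₂) (locMul e₁ e₂)
  bound : {s : Sorts} → Const s → Const s → Loc s

structure LStructure (L : LocalLanguage) : Type 1 where
  Dom : L.Sorts → Type
  relMap : {n : ℕ} → {ρ : Fin n → L.Sorts} → L.Rel n ρ → ((i : Fin n) → Dom (ρ i)) → Prop
  constMap : {s : L.Sorts} → L.Const s → Dom s

def dpair {C : Fin 2 → Sort*} (a : C 0) (b : C 1) : (i : Fin 2) → C i
  | ⟨0, _⟩ => a
  | ⟨1, _⟩ => b

def LStructure.locRel {L : LocalLanguage} (M : LStructure L) {s : L.Sorts}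
    (d : L.Loc s) (a b : M.Dom s) : Prop :=
  M.relMap (L.locToRel d) (dpair a b)

structure IsLocal {L : LocalLanguage} (M : LStructure L) : Prop where
  symm : ∀ {s : L.Sorts} (d : L.Loc s) (a b : M.Dom s), M.locRel d a b → M.locRel d b a
  mono : ∀ {s : L.Sorts} (d₁ d₂ : L.Loc s), L.locLe d₁ d₂ →
    ∀ (a b : M.Dom s), M.locRel d₁ a b → M.locRel d₂ a b
  comp : ∀ {s : L.Sorts} (d₁ d₂ : L.Loc s) (a b c : M.Dom s),
    M.locRel d₁ a b → M.locRel d₂ b c → M.locRel (L.locMul d₁ d₂) a c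
  boundAx : ∀ {s : L.Sorts} (c₁ c₂ : L.Const s),
    M.locRel (L.bound c₁ c₂) (M.constMap c₁) (M.constMap c₂)
  total : ∀ {s : L.Sorts} (a b : M.Dom s), ∃ d : L.Loc s, M.locRel d a b
  dd0_eq : ∀ {s : L.Sorts} (a b : M.Dom s), M.locRel (L.dd0 s) a b ↔ a = b

/-! ## Syntax -/

/-- Terms: variables or constants (the language is relational). -/
inductive LTerm (L : LocalLanguage) (α : Type) (σ : α → L.Sorts) : L.Sorts → Type
  | var (a : α) : LTerm L α σ (σ a)
  | const {s : L.Sorts} (c : L.Const s) : LTerm L α σ s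

/-- Sort assignment for a context extended by one variable of sort `s`. -/
abbrev osort {L : LocalLanguage} {α : Type} (s : L.Sorts) (σ : α → L.Sorts) :
    Option α → L.Sorts :=
  fun o => Option.elim o s σ

/-- Positive formulas: atomic, conjunction, disjunction, existential quantification. -/
inductive PosForm (L : LocalLanguage) : (α : Type) → (α → L.Sorts) → Type 1
  | rel {α : Type} {σ : α → L.Sorts} {n : ℕ} {ρ : Fin n → L.Sorts}
      (R : L.Rel n ρ) (ts : (i : Fin n) → LTerm L α σ (ρ i)) : PosForm L α σ
  | and {α : Type} {σ : α → L.Sorts} (φ ψ : PosForm L α σ) : PosForm L α σ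
  | or {α : Type} {σ : α → L.Sorts} (φ ψ : PosForm L α σ) : PosForm L α σ
  | ex {α : Type} {σ : α → L.Sorts} (s : L.Sorts)
      (φ : PosForm L (Option α) (osort s σ)) : PosForm L α σ

/-- Local positive formulas: atomic, conjunction, disjunction, local existential
quantification `∃ x ∈ d(t) φ`. -/
inductive LPosForm (L : LocalLanguage) : (α : Type) → (α → L.Sorts) → Type 1
  | rel {α : Type} {σ : α → L.Sorts} {n : ℕ} {ρ : Fin n → L.Sorts}
      (R : L.Rel n ρ) (ts : (i : Fin n) → LTerm L α σ (ρ i)) : LPosForm L α σ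
  | and {α : Type} {σ : α → L.Sorts} (φ ψ : LPosForm L α σ) : LPosForm L α σ
  | or {α : Type} {σ : α → L.Sorts} (φ ψ : LPosForm L α σ) : LPosForm L α σ
  | lex {α : Type} {σ : α → L.Sorts} (s : L.Sorts) (d : L.Loc s) (t : LTerm L α σ s)
      (φ : LPosForm L (Option α) (osort s σ)) : LPosForm L α σ

/-- Local formulas: atomic, negation, conjunction, local existential quantification. -/
inductive LForm (L : LocalLanguage) : (α : Type) → (α → L.Sorts) → Type 1
  | rel {α : Type} {σ : α → L.Sorts} {n : ℕ} {ρ : Fin n → L.Sorts}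
      (R : L.Rel n ρ) (ts : (i : Fin n) → LTerm L α σ (ρ i)) : LForm L α σ
  | not {α : Type} {σ : α → L.Sorts} (φ : LForm L α σ) : LForm L α σ
  | and {α : Type} {σ : α → L.Sorts} (φ ψ : LForm L α σ) : LForm L α σ
  | lex {α : Type} {σ : α → L.Sorts} (s : L.Sorts) (d : L.Loc s) (t : LTerm L α σ s)
      (φ : LForm L (Option α) (osort s σ)) : LForm L α σ

/-! ## Semantics -/

def LTerm.realize {L : LocalLanguage} (M : LStructure L) {α : Type} {σ : α → L.Sorts}
    (v : (a : α) → M.Dom (σ a)) : {s : L.Sorts} → LTerm L α σ s → M.Dom s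
  | _, .var a => v a
  | _, .const c => M.constMap c

/-- Extension of a valuation by a value for the new variable. -/
def vcons {L : LocalLanguage} {M : LStructure L} {α : Type} {σ : α → L.Sorts} {s : L.Sorts}
    (x : M.Dom s) (v : (a : α) → M.Dom (σ a)) : (o : Option α) → M.Dom (osort s σ o)
  | none => x
  | some a => v a

def PosForm.Realize {L : LocalLanguage} (M : LStructure L) :
    {α : Type} → {σ : α → L.Sorts} → PosForm L α σ → ((a : α) → M.Dom (σ a)) → Prop
  | _, _, .rel R ts, v => M.relMap R (fun i => (ts i).realize M v)
  | _, _, .and φ ψ, v => φ.Realize M v ∧ ψ.Realize M v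
  | _, _, .or φ ψ, v => φ.Realize M v ∨ ψ.Realize M v
  | _, _, .ex s φ, v => ∃ x : M.Dom s, φ.Realize M (vcons x v)

def LPosForm.Realize {L : LocalLanguage} (M : LStructure L) :
    {α : Type} → {σ : α → L.Sorts} → LPosForm L α σ → ((a : α) → M.Dom (σ a)) → Prop
  | _, _, .rel R ts, v => M.relMap R (fun i => (ts i).realize M v)
  | _, _, .and φ ψ, v => φ.Realize M v ∧ ψ.Realize M v
  | _, _, .or φ ψ, v => φ.Realize M v ∨ ψ.Realize M v
  | _, _, .lex s d t φ, v =>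
      ∃ x : M.Dom s, M.locRel d x (t.realize M v) ∧ φ.Realize M (vcons x v)

def LForm.Realize {L : LocalLanguage} (M : LStructure L) :
    {α : Type} → {σ : α → L.Sorts} → LForm L α σ → ((a : α) → M.Dom (σ a)) → Prop
  | _, _, .rel R ts, v => M.relMap R (fun i => (ts i).realize M v)
  | _, _, .not φ, v => ¬ φ.Realize M v
  | _, _, .and φ ψ, v => φ.Realize M v ∧ ψ.Realize M v
  | _, _, .lex s d t φ, v =>
      ∃ x : M.Dom s, M.locRel d x (t.realize M v) ∧ φ.Realize M (vcons x v)

/-- Quantifier-free positive formulas. -/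
inductive PosForm.IsQF {L : LocalLanguage} : {α : Type} → {σ : α → L.Sorts} → PosForm L α σ → Prop
  | rel {α : Type} {σ : α → L.Sorts} {n : ℕ} {ρ : Fin n → L.Sorts}
      (R : L.Rel n ρ) (ts : (i : Fin n) → LTerm L α σ (ρ i)) : PosForm.IsQF (.rel R ts)
  | and {α : Type} {σ : α → L.Sorts} {φ ψ : PosForm L α σ} :
      PosForm.IsQF φ → PosForm.IsQF ψ → PosForm.IsQF (.and φ ψ)
  | or {α : Type} {σ : α → L.Sorts} {φ ψ : PosForm L α σ} :
      PosForm.IsQF φ → PosForm.IsQF ψ → PosForm.IsQF (.or φ ψ)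


/-! ## Sentences, theories, models -/

/-- Sort assignment for the empty context. -/
abbrev emptySorts (L : LocalLanguage) : Empty → L.Sorts := fun e => e.elim

/-- Positive sentences. -/
abbrev PosSentence (L : LocalLanguage) := PosForm L Empty (emptySorts L)

/-- A positive sentence holds in a structure. -/
def PosSentence.RealizedIn {L : LocalLanguage} (φ : PosSentence L) (M : LStructure L) : Prop :=
  φ.Realize M (fun e => e.elim)

/-- We represent a negative theory by the set of positive sentences whose negations
belong to it.  `M` is a local model of `T` if `M` is local and satisfies the negation of
every positive sentence in `T`. -/
def LocalModel {L : LocalLanguage} (M : LStructure L) (T : Set (PosSentence L)) : Prop :=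
  IsLocal M ∧ ∀ φ ∈ T, ¬ φ.RealizedIn M

/-- `T` (a set of positive sentences standing for the negative theory `{¬φ : φ ∈ T}`)
is a negative local theory if it is closed under local implication: any negative sentence
true in every local model of `T` is already in `T`. -/
def IsNegLocalTheory {L : LocalLanguage} (T : Set (PosSentence L)) : Prop :=
  ∀ φ : PosSentence L, (∀ M : LStructure L, LocalModel M T → ¬ φ.RealizedIn M) → φ ∈ T

/-- `T` is locally satisfiable: it has a local model. -/
def LocSat {L : LocalLanguage} (T : Set (PosSentence L)) : Prop :=
  ∃ M : LStructure L, LocalModel M T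

/-- The negative theory of a structure (as the set of positive sentences failing in it). -/
def ThNeg {L : LocalLanguage} (M : LStructure L) : Set (PosSentence L) :=
  {φ | ¬ φ.RealizedIn M}

/-! ## Homomorphisms -/

structure LHom {L : LocalLanguage} (M N : LStructure L) where
  toFun : (s : L.Sorts) → M.Dom s → N.Dom s
  map_rel : ∀ {n : ℕ} {ρ : Fin n → L.Sorts} (R : L.Rel n ρ) (x : (i : Fin n) → M.Dom (ρ i)),
    M.relMap R x → N.relMap R (fun i => toFun (ρ i) (x i))
  map_const : ∀ {s : L.Sorts} (c : L.Const s), toFun s (M.constMap c) = N.constMap c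

def LHom.comp {L : LocalLanguage} {M N P : LStructure L} (g : LHom N P) (f : LHom M N) :
    LHom M P where
  toFun s := g.toFun s ∘ f.toFun s
  map_rel R x h := g.map_rel R _ (f.map_rel R x h)
  map_const c := by
    simp only [Function.comp_apply, f.map_const, g.map_const]

def LHom.id {L : LocalLanguage} (M : LStructure L) : LHom M M where
  toFun _ := fun x => x
  map_rel _ _ h := h
  map_const _ := rfl

/-- A homomorphism is a positive embedding if it reflects all positive formulas. -/
def LHom.IsPosEmbedding {L : LocalLanguage} {M N : LStructure L} (h : LHom M N) : Prop :=
  ∀ (α : Type) (σ : α → L.Sorts) (φ : PosForm L α σ) (v : (a : α) → M.Dom (σ a)),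
    φ.Realize N (fun a => h.toFun (σ a) (v a)) → φ.Realize M v

/-- A local positively closed model of `T`. -/
def IsPC {L : LocalLanguage} (M : LStructure L) (T : Set (PosSentence L)) : Prop :=
  LocalModel M T ∧
    ∀ (N : LStructure L) (h : LHom M N), LocalModel N T → h.IsPosEmbedding

/-- An endomorphism is an automorphism if it has a two-sided inverse homomorphism. -/
def LHom.IsAuto {L : LocalLanguage} {M : LStructure L} (f : LHom M M) : Prop :=
  ∃ g : LHom M M, g.comp f = LHom.id M ∧ f.comp g = LHom.id M

/-- Isomorphism of structures. -/
def Isomorphic {L : LocalLanguage} (M N : LStructure L) : Prop :=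
  ∃ (f : LHom M N) (g : LHom N M), g.comp f = LHom.id M ∧ f.comp g = LHom.id N

/-! ## Types -/

/-- The local positive type of a tuple. -/
def ltp {L : LocalLanguage} (M : LStructure L) {α : Type} {σ : α → L.Sorts}
    (v : (a : α) → M.Dom (σ a)) : Set (LPosForm L α σ) :=
  {φ | φ.Realize M v}

/-- The positive type of a tuple. -/
def ptp {L : LocalLanguage} (M : LStructure L) {α : Type} {σ : α → L.Sorts}
    (v : (a : α) → M.Dom (σ a)) : Set (PosForm L α σ) :=
  {φ | φ.Realize M v}

/-- A partial local positive type of `T` on `(α, σ)`: a set of local positive formulas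
realized by some tuple in some local model of `T`. -/
def IsPartialLType {L : LocalLanguage} (T : Set (PosSentence L)) {α : Type}
    {σ : α → L.Sorts} (Γ : Set (LPosForm L α σ)) : Prop :=
  ∃ (M : LStructure L) (v : (a : α) → M.Dom (σ a)),
    LocalModel M T ∧ ∀ φ ∈ Γ, LPosForm.Realize M φ v

/-- A local positive type: a maximal partial local positive type. -/
def IsLType {L : LocalLanguage} (T : Set (PosSentence L)) {α : Type}
    {σ : α → L.Sorts} (Γ : Set (LPosForm L α σ)) : Prop :=
  IsPartialLType T Γ ∧ ∀ Γ' : Set (LPosForm L α σ), IsPartialLType T Γ' → Γ ⊆ Γ' → Γ' = Γ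

/-- A variable `(α, σ)` is pointed if every sort not occurring among its sorts carries a
constant symbol. -/
def VPointed {L : LocalLanguage} {α : Type} (σ : α → L.Sorts) : Prop :=
  ∀ s : L.Sorts, s ∉ Set.range σ → Nonempty (L.Const s)


/-! ## Bounds and bounded satisfiability -/

/-- Pair of terms as arguments for a binary relation symbol. -/
def tpair {L : LocalLanguage} {α : Type} {σ : α → L.Sorts} {s t : L.Sorts}
    (t₁ : LTerm L α σ s) (t₂ : LTerm L α σ t) : (i : Fin 2) → LTerm L α σ (![s, t] i) :=
  dpair t₁ t₂

/-- A bound of the variable `(α, σ)`: a choice, for every single variable whose sort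
carries a constant symbol, of a locality relation and a constant, and for every pair of
single variables of the same sort, of a locality relation. -/
structure VBound (L : LocalLanguage) (α : Type) (σ : α → L.Sorts) where
  dConst : (a : α) → Nonempty (L.Const (σ a)) → L.Loc (σ a)
  cConst : (a : α) → Nonempty (L.Const (σ a)) → L.Const (σ a)
  dPair : (a b : α) → σ a = σ b → L.Loc (σ a)

/-- The set of (atomic, quantifier-free) local positive formulas making up a bound:
`d_a(x_a, c_a)` and `d_{a,b}(x_a, x_b)`. -/
def VBound.toSet {L : LocalLanguage} {α : Type} {σ : α → L.Sorts} (B : VBound L α σ) :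
    Set (LPosForm L α σ) :=
  {φ | (∃ (a : α) (h : Nonempty (L.Const (σ a))),
          φ = LPosForm.rel (L.locToRel (B.dConst a h))
                (tpair (LTerm.var a) (LTerm.const (B.cConst a h)))) ∨
       (∃ (a b : α) (e : σ a = σ b),
          φ = LPosForm.rel (L.locToRel (B.dPair a b e))
                (tpair (LTerm.var a) (e.symm ▸ LTerm.var b)))}

/-- A bound holds of a tuple if all its formulas do. -/
def VBound.Holds {L : LocalLanguage} {α : Type} {σ : α → L.Sorts} (B : VBound L α σ)
    (M : LStructure L) (v : (a : α) → M.Dom (σ a)) : Prop :=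
  ∀ ψ ∈ B.toSet, LPosForm.Realize M ψ v

/-- Finite local satisfiability of a set of local positive formulas in `T`. -/
def FinLocSat {L : LocalLanguage} (T : Set (PosSentence L)) {α : Type} {σ : α → L.Sorts}
    (Δ : Set (LPosForm L α σ)) : Prop :=
  ∀ Δ₀ ⊆ Δ, Δ₀.Finite →
    ∃ (M : LStructure L) (v : (a : α) → M.Dom (σ a)),
      LocalModel M T ∧ ∀ φ ∈ Δ₀, LPosForm.Realize M φ v

/-- Bounded satisfiability: for some bound `B`, `Γ ∪ B` is finitely locally satisfiable. -/
def BoundedlySat {L : LocalLanguage} (T : Set (PosSentence L)) {α : Type}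
    {σ : α → L.Sorts} (Γ : Set (LPosForm L α σ)) : Prop :=
  ∃ B : VBound L α σ, FinLocSat T (Γ ∪ B.toSet)

/-! ## Π₁-local formulas -/

/-- Dependent `Sum.elim` of valuations. -/
def sval {L : LocalLanguage} {M : LStructure L} {α β : Type} {σ : α → L.Sorts}
    {τ : β → L.Sorts} (v : (a : α) → M.Dom (σ a)) (w : (b : β) → M.Dom (τ b)) :
    (x : α ⊕ β) → M.Dom (Sum.elim σ τ x)
  | .inl a => v a
  | .inr b => w b

/-- A Π₁-local formula: a universally quantified local formula. -/
structure Pi1LForm (L : LocalLanguage) (α : Type) (σ : α → L.Sorts) : Type 1 where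
  n : ℕ
  τ : Fin n → L.Sorts
  matrix : LForm L (α ⊕ Fin n) (Sum.elim σ τ)

def Pi1LForm.Realize {L : LocalLanguage} {α : Type} {σ : α → L.Sorts}
    (φ : Pi1LForm L α σ) (M : LStructure L) (v : (a : α) → M.Dom (σ a)) : Prop :=
  ∀ w : (i : Fin φ.n) → M.Dom (φ.τ i), φ.matrix.Realize M (sval v w)

/-- Bounded satisfiability of a set of Π₁-local formulas: for some bound `B`, every
finite subset of `Γ` together with every finite part of `B` is realized in a local
model of `T`. -/
def Pi1BoundedlySat {L : LocalLanguage} (T : Set (PosSentence L)) {α : Type}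
    {σ : α → L.Sorts} (Γ : Set (Pi1LForm L α σ)) : Prop :=
  ∃ B : VBound L α σ,
    ∀ Γ₀ ⊆ Γ, Γ₀.Finite → ∀ F ⊆ B.toSet, F.Finite →
      ∃ (M : LStructure L) (v : (a : α) → M.Dom (σ a)),
        LocalModel M T ∧ (∀ φ ∈ Γ₀, Pi1LForm.Realize φ M v) ∧
          (∀ ψ ∈ F, LPosForm.Realize M ψ v)

/-! ## Cardinality, homogeneity, retractors -/

/-- The cardinality of a structure: that of the disjoint union of its sorts. -/
def LStructure.card {L : LocalLanguage} (M : LStructure L) : Cardinal :=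
  Cardinal.mk (Σ s : L.Sorts, M.Dom s)

/-- The cardinality of a local language. -/
def LocalLanguage.card (L : LocalLanguage) : Cardinal :=
  max Cardinal.aleph0
    (Cardinal.mk (L.Sorts ⊕ (Σ s : L.Sorts, L.Const s) ⊕ (Σ s : L.Sorts, L.Loc s) ⊕
      (Σ (n : ℕ) (ρ : Fin n → L.Sorts), L.Rel n ρ)))

/-- `M` is a (local positively) κ-ultrahomogeneous model of `T`. -/
def IsUltrahomogeneous {L : LocalLanguage} (T : Set (PosSentence L)) (M : LStructure L)
    (κ : Cardinal) : Prop :=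
  ∀ A B : LStructure L, LocalModel A T → LocalModel B T → A.card < κ → B.card < κ →
    ∀ f : LHom A M, f.IsPosEmbedding → ∀ g : LHom A B, ∃ h : LHom B M, h.comp g = f

/-- A retractor of `T`: a local model of `T` such that every homomorphism into a local
model of `T` has a retraction. -/
def IsRetractor {L : LocalLanguage} (T : Set (PosSentence L)) (C : LStructure L) : Prop :=
  LocalModel C T ∧
    ∀ N : LStructure L, LocalModel N T →
      ∀ f : LHom C N, ∃ g : LHom N C, g.comp f = LHom.id C

/-- `M` is κ-universal for a class `K` of structures. -/
def IsUniversal {L : LocalLanguage} (M : LStructure L) (K : LStructure L → Prop)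
    (κ : Cardinal) : Prop :=
  ∀ N : LStructure L, K N → N.card < κ → Nonempty (LHom N M)

/-- `M` is absolutely universal for a class `K` of structures. -/
def IsAbsUniversal {L : LocalLanguage} (M : LStructure L) (K : LStructure L → Prop) : Prop :=
  ∀ N : LStructure L, K N → Nonempty (LHom N M)

/-- Compatibility of two local models of `T`. -/
def Compat {L : LocalLanguage} (T : Set (PosSentence L)) (A B : LStructure L) : Prop :=
  ∃ M : LStructure L, LocalModel M T ∧ Nonempty (LHom A M) ∧ Nonempty (LHom B M)

/-- The local joint (homomorphism) property. -/
def HasLJP {L : LocalLanguage} (T : Set (PosSentence L)) : Prop :=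
  ∀ A B : LStructure L, LocalModel A T → LocalModel B T →
    ∃ M : LStructure L, LocalModel M T ∧ Nonempty (LHom A M) ∧ Nonempty (LHom B M)


/-! ## Parameters -/

/-- A set of parameters in a structure. -/
def ParamSet {L : LocalLanguage} (M : LStructure L) := (s : L.Sorts) → Set (M.Dom s)

/-- Interpretation in `M` of old and new constants of the expanded language. -/
def paramInterp {L : LocalLanguage} (M : LStructure L) (A : ParamSet M) {s : L.Sorts} :
    L.Const s ⊕ (A s) → M.Dom s
  | .inl c => M.constMap c
  | .inr a => a.1

/-- The expansion `L(A)` of `L` by new constants for the parameters `A` of a local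
structure `M`; bounds for pairs involving the new constants are chosen (by locality
axiom (A5)) so that they hold in `M`. -/
noncomputable def LocalLanguage.withParams (L : LocalLanguage) (M : LStructure L)
    (hM : IsLocal M) (A : ParamSet M) : LocalLanguage where
  Sorts := L.Sorts
  Rel := L.Rel
  Const s := L.Const s ⊕ (A s)
  Loc := L.Loc
  locToRel := L.locToRel
  dd0 := L.dd0
  locMul := L.locMul
  locLe := L.locLe
  locMul_assoc := L.locMul_assoc
  dd0_locMul := L.dd0_locMul
  locMul_dd0 := L.locMul_dd0
  locLe_refl := L.locLe_refl
  locLe_trans := L.locLe_trans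
  locLe_antisymm := L.locLe_antisymm
  dd0_locLe := L.dd0_locLe
  locMul_mono := L.locMul_mono
  bound := fun {_s} c₁ c₂ =>
    match c₁, c₂ with
    | .inl c₁, .inl c₂ => L.bound c₁ c₂
    | c₁, c₂ => Classical.choose (hM.total (paramInterp M A c₁) (paramInterp M A c₂))

/-- The natural expansion `M_A` of `M` to an `L(A)`-structure. -/
noncomputable def LStructure.withParams {L : LocalLanguage} (M : LStructure L)
    (hM : IsLocal M) (A : ParamSet M) : LStructure (L.withParams M hM A) where
  Dom := M.Dom
  relMap := M.relMap
  constMap := paramInterp M A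

/-- `M` has the local joint property over `A`: any two local models of `Th₋(M/A)` map
into a common local model of `Th₋(M/A)`. -/
def HasLJPOver {L : LocalLanguage} (M : LStructure L) (hM : IsLocal M) (A : ParamSet M) :
    Prop :=
  HasLJP (ThNeg (M.withParams hM A))

/-- `M` is (local positively) κ-saturated: it realizes every local positive type of
`Th₋(M/A)` on `x` whenever `|x| < κ`, `|A| < κ` and `M` has the local joint property
over `A`. -/
def IsSaturatedAt {L : LocalLanguage} (M : LStructure L) (hM : IsLocal M)
    (κ : Cardinal) : Prop :=
  ∀ A : ParamSet M, Cardinal.mk (Σ s : L.Sorts, A s) < κ → HasLJPOver M hM A →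
    ∀ (α : Type) (σ : α → L.Sorts), Cardinal.mk α < κ →
      ∀ Γ : Set (LPosForm (L.withParams M hM A) α σ),
        IsLType (ThNeg (M.withParams hM A)) Γ →
          ∃ v : (a : α) → M.Dom (σ a), ∀ φ ∈ Γ, LPosForm.Realize (M.withParams hM A) φ v

/-- The local positive type of a tuple over a set of parameters `A`, rendered as the set
of local positive formulas with extra free variables for the parameters of `A` that are
satisfied when those variables are evaluated at the parameters themselves. -/
def ltpOver {L : LocalLanguage} (M : LStructure L) (A : ParamSet M) {α : Type}
    {σ : α → L.Sorts} (v : (a : α) → M.Dom (σ a)) :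
    Set (LPosForm L (α ⊕ Σ s : L.Sorts, A s) (Sum.elim σ (fun p => p.1))) :=
  {φ | φ.Realize M (sval v (fun p => p.2.1))}

/-! ## Substructures -/

/-- A substructure of `M`: a family of subsets closed under the constants (the language
is relational). -/
structure Substruct {L : LocalLanguage} (M : LStructure L) where
  carrier : (s : L.Sorts) → Set (M.Dom s)
  const_mem : ∀ {s : L.Sorts} (c : L.Const s), M.constMap c ∈ carrier s

/-- The induced structure on a substructure. -/
def Substruct.toStruct {L : LocalLanguage} {M : LStructure L} (A : Substruct M) :
    LStructure L where
  Dom s := A.carrier s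
  relMap R x := M.relMap R (fun i => (x i).1)
  constMap c := ⟨M.constMap c, A.const_mem c⟩


/-! ## Topologies -/

/-- The `d`-ball at `a`. -/
def LStructure.ball {L : LocalLanguage} (M : LStructure L) {s : L.Sorts} (d : L.Loc s)
    (a : M.Dom s) : Set (M.Dom s) :=
  {b | M.locRel d a b}

/-- The local positive logic topology on a single sort of `M`: closed sets are the
subsets defined by sets of local positive formulas with parameters in `M` (parameters
being rendered as extra free variables evaluated at themselves). -/
def lpTopologyS {L : LocalLanguage} (M : LStructure L) (s : L.Sorts) :
    TopologicalSpace (M.Dom s) :=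
  TopologicalSpace.generateFrom
    {U | ∃ φ : LPosForm L (Unit ⊕ Σ s' : L.Sorts, M.Dom s')
            (Sum.elim (fun _ => s) (fun p => p.1)),
      U = {x | ¬ LPosForm.Realize M φ (sval (fun _ => x) (fun p => p.2))}}

/-- The space of local positive types of `T` on the variable `(α, σ)`. -/
def LTypeSpace (L : LocalLanguage) (T : Set (PosSentence L)) (α : Type)
    (σ : α → L.Sorts) :=
  {Γ : Set (LPosForm L α σ) // IsLType T Γ}

/-- The local positive logic topology on the space of local positive types: generated by
declaring `⟨φ⟩ = {p : φ ∈ p}` closed for every local positive formula `φ`; its closed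
sets are then exactly the sets `⟨Γ⟩` together with `∅`. -/
instance {L : LocalLanguage} (T : Set (PosSentence L)) (α : Type) (σ : α → L.Sorts) :
    TopologicalSpace (LTypeSpace L T α σ) :=
  TopologicalSpace.generateFrom
    {U | ∃ φ : LPosForm L α σ, U = {p : LTypeSpace L T α σ | φ ∉ p.1}}

/-! ## Completeness and compactness -/

/-- `T` is complete: `T = Th₋(M)` for every local positively closed model `M` of `T`. -/
def IsCompleteTheory {L : LocalLanguage} (T : Set (PosSentence L)) : Prop :=
  ∀ M : LStructure L, IsPC M T → ThNeg M = T

/-- `T` is local positively compact. -/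
def IsLocPosCompact {L : LocalLanguage} (T : Set (PosSentence L)) : Prop :=
  ∀ (s : L.Sorts) (γ : Type), Finite γ →
    ∀ (τ : γ → L.Sorts) (φ : LPosForm L (Fin 2 ⊕ γ) (Sum.elim (fun _ => s) τ)),
      (∀ M : LStructure L, LocalModel M T →
        ∀ (a : M.Dom s) (w : (j : γ) → M.Dom (τ j)),
          ¬ LPosForm.Realize M φ (sval ![a, a] w)) →
      ∀ (B : VBound L (Unit ⊕ γ) (Sum.elim (fun _ => s) τ)) (d : L.Loc s),
        ∃ k : ℕ, 0 < k ∧ ∀ M : LStructure L, LocalModel M T →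
          ¬ ∃ (a : Fin k → M.Dom s) (w : (j : γ) → M.Dom (τ j)),
            ∀ i j : Fin k, i ≠ j →
              B.Holds M (sval (fun _ => a i) w) ∧ M.locRel d (a i) (a j) ∧
                LPosForm.Realize M φ (sval ![a i, a j] w)

/-! ## Homomorphisms and positive formulas -/

theorem LHom.ext {L : LocalLanguage} {M N : LStructure L} {f g : LHom M N}
    (h : ∀ s x, f.toFun s x = g.toFun s x) : f = g := by
  cases f; cases g
  congr
  funext s x
  exact h s x

theorem LHom.congr_toFun {L : LocalLanguage} {M N : LStructure L} {f g : LHom M N} (h : f = g)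
    (s : L.Sorts) (x : M.Dom s) : f.toFun s x = g.toFun s x := by
  rw [h]

theorem LHom.map_dpair {L : LocalLanguage} {M N : LStructure L}
    (f : (s : L.Sorts) → M.Dom s → N.Dom s) {s : L.Sorts} (a b : M.Dom s) :
    (fun i : Fin 2 => f (![s, s] i) (dpair (C := fun i => M.Dom (![s, s] i)) a b i)) =
      dpair (C := fun i => N.Dom (![s, s] i)) (f s a) (f s b) := by
  funext i
  match i with
  | ⟨0, _⟩ => rfl
  | ⟨1, _⟩ => rfl

theorem LHom.map_locRel {L : LocalLanguage} {M N : LStructure L} (h : LHom M N) {s : L.Sorts}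
    (d : L.Loc s) {a b : M.Dom s} (hab : M.locRel d a b) :
    N.locRel d (h.toFun s a) (h.toFun s b) := by
  have := h.map_rel _ _ hab
  rwa [LHom.map_dpair h.toFun a b] at this

theorem LTerm.realize_map {L : LocalLanguage} {M N : LStructure L} (h : LHom M N) {α : Type}
    {σ : α → L.Sorts} (v : (a : α) → M.Dom (σ a)) {s : L.Sorts} (t : LTerm L α σ s) :
    t.realize N (fun a => h.toFun (σ a) (v a)) = h.toFun s (t.realize M v) := by
  cases t with
  | var a => rfl
  | const c => exact (h.map_const c).symm

theorem vcons_map {L : LocalLanguage} {M N : LStructure L}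
    (f : (s : L.Sorts) → M.Dom s → N.Dom s) {α : Type} {σ : α → L.Sorts} {s : L.Sorts}
    (x : M.Dom s) (v : (a : α) → M.Dom (σ a)) :
    (fun o => f (osort s σ o) (vcons x v o)) = vcons (M := N) (f s x) (fun a => f (σ a) (v a)) := by
  funext o
  cases o <;> rfl

theorem PosForm.Realize.map {L : LocalLanguage} {M N : LStructure L} (h : LHom M N) {α : Type}
    {σ : α → L.Sorts} (φ : PosForm L α σ) :
    ∀ {v : (a : α) → M.Dom (σ a)}, φ.Realize M v →
      φ.Realize N (fun a => h.toFun (σ a) (v a)) := by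
  induction φ with
  | rel R ts =>
    intro v hv
    simp only [PosForm.Realize, LTerm.realize_map]
    exact h.map_rel R _ hv
  | and φ ψ ihφ ihψ => exact fun hv => ⟨ihφ hv.1, ihψ hv.2⟩
  | or φ ψ ihφ ihψ => exact fun hv => hv.imp ihφ ihψ
  | ex s φ ih =>
    rintro v ⟨x, hx⟩
    refine ⟨h.toFun s x, ?_⟩
    rw [← vcons_map]
    exact ih hx

theorem PosSentence.realizedIn_iff {L : LocalLanguage} {M : LStructure L} {φ : PosSentence L}
    (v : (e : Empty) → M.Dom (emptySorts L e)) : φ.RealizedIn M ↔ φ.Realize M v := by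
  rw [PosSentence.RealizedIn, Subsingleton.elim v]

/-! ## Substructures and transport along bijections -/

def Substruct.incl {L : LocalLanguage} {M : LStructure L} (A : Substruct M) :
    LHom A.toStruct M where
  toFun _ x := x.1
  map_rel _ _ h := h
  map_const _ := rfl

/-- Transport of a structure along a family of bijections. -/
def LStructure.transport {L : LocalLanguage} (M : LStructure L) {D : L.Sorts → Type}
    (e : (s : L.Sorts) → M.Dom s ≃ D s) : LStructure L where
  Dom := D
  relMap {_ ρ} R x := M.relMap R (fun i => (e (ρ i)).symm (x i))
  constMap {s} c := e s (M.constMap c)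

def LStructure.toTransport {L : LocalLanguage} (M : LStructure L) {D : L.Sorts → Type}
    (e : (s : L.Sorts) → M.Dom s ≃ D s) : LHom M (M.transport e) where
  toFun s := e s
  map_rel R x h := by simpa [LStructure.transport] using h
  map_const _ := rfl

def LStructure.ofTransport {L : LocalLanguage} (M : LStructure L) {D : L.Sorts → Type}
    (e : (s : L.Sorts) → M.Dom s ≃ D s) : LHom (M.transport e) M where
  toFun s := (e s).symm
  map_rel _ _ h := h
  map_const _ := by simp [LStructure.transport]

/-! ## Directed colimits of structures -/

/-- A directed system of structures. -/
structure LSystem (L : LocalLanguage) (J : Type) [Preorder J] where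
  obj : J → LStructure L
  map : {i j : J} → i ≤ j → LHom (obj i) (obj j)
  map_refl : ∀ {i : J} {s : L.Sorts} (x : (obj i).Dom s), (map (le_refl i)).toFun s x = x
  map_map : ∀ {i j k : J} (hij : i ≤ j) (hjk : j ≤ k) {s : L.Sorts} (x : (obj i).Dom s),
    (map hjk).toFun s ((map hij).toFun s x) = (map (hij.trans hjk)).toFun s x

namespace LSystem

variable {L : LocalLanguage} {J : Type} [Preorder J] [IsDirectedOrder J]
  (X : LSystem L J)

/-- Two elements of a directed system are identified when they become equal at a later stage. -/
def setoid (s : L.Sorts) : Setoid (Σ j, (X.obj j).Dom s) where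
  r p q := ∃ (k : J) (hp : p.1 ≤ k) (hq : q.1 ≤ k),
    (X.map hp).toFun s p.2 = (X.map hq).toFun s q.2
  iseqv :=
    { refl := fun p => ⟨p.1, le_rfl, le_rfl, rfl⟩
      symm := fun ⟨k, hp, hq, h⟩ => ⟨k, hq, hp, h.symm⟩
      trans := by
        rintro p q r ⟨k, hp, hq, h⟩ ⟨k', hq', hr, h'⟩
        obtain ⟨l, hl, hl'⟩ := exists_ge_ge k k'
        refine ⟨l, hp.trans hl, hr.trans hl', ?_⟩
        rw [← X.map_map hp hl, h, X.map_map, ← X.map_map hr hl', ← h', X.map_map] }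

/-- The colimit of a directed system. -/
def colim [Nonempty J] : LStructure L where
  Dom s := Quotient (X.setoid s)
  relMap {_ ρ} R x := ∃ (j : J) (y : ∀ i, (X.obj j).Dom (ρ i)),
    (∀ i, x i = Quotient.mk (X.setoid (ρ i)) ⟨j, y i⟩) ∧ (X.obj j).relMap R y
  constMap {s} c := Quotient.mk (X.setoid s) ⟨Classical.arbitrary J, (X.obj _).constMap c⟩

theorem mk_eq_iff {s : L.Sorts} {i j : J} (x : (X.obj i).Dom s) (y : (X.obj j).Dom s) :
    Quotient.mk (X.setoid s) ⟨i, x⟩ = Quotient.mk (X.setoid s) ⟨j, y⟩ ↔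
      ∃ (k : J) (hi : i ≤ k) (hj : j ≤ k), (X.map hi).toFun s x = (X.map hj).toFun s y :=
  Quotient.eq

variable [Nonempty J]

/-- The canonical homomorphism from a stage to the colimit. -/
def ι (j : J) : LHom (X.obj j) X.colim where
  toFun s x := Quotient.mk (X.setoid s) ⟨j, x⟩
  map_rel _ x h := ⟨j, x, fun _ => rfl, h⟩
  map_const {s} c := by
    obtain ⟨k, hk, hk'⟩ := exists_ge_ge j (Classical.arbitrary J)
    refine (X.mk_eq_iff _ _).2 ⟨k, hk, hk', ?_⟩
    rw [LHom.map_const, LHom.map_const]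

theorem ι_eq_iff {s : L.Sorts} {i j : J} (x : (X.obj i).Dom s) (y : (X.obj j).Dom s) :
    (X.ι i).toFun s x = (X.ι j).toFun s y ↔
      ∃ (k : J) (hi : i ≤ k) (hj : j ≤ k), (X.map hi).toFun s x = (X.map hj).toFun s y :=
  X.mk_eq_iff x y

theorem ι_map {i j : J} (h : i ≤ j) {s : L.Sorts} (x : (X.obj i).Dom s) :
    (X.ι j).toFun s ((X.map h).toFun s x) = (X.ι i).toFun s x :=
  (X.ι_eq_iff _ _).2 ⟨j, le_rfl, h, X.map_refl _⟩

theorem exists_ι_eq {s : L.Sorts} (x : X.colim.Dom s) :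
    ∃ (j : J) (y : (X.obj j).Dom s), (X.ι j).toFun s y = x := by
  obtain ⟨⟨j, y⟩, rfl⟩ := Quotient.exists_rep x
  exact ⟨j, y, rfl⟩

theorem exists_ι_eq_of_le {s : L.Sorts} (x : X.colim.Dom s) (i : J) :
    ∃ (j : J) (_ : i ≤ j) (y : (X.obj j).Dom s), (X.ι j).toFun s y = x := by
  obtain ⟨j, y, rfl⟩ := X.exists_ι_eq x
  obtain ⟨k, hi, hj⟩ := exists_ge_ge i j
  exact ⟨k, hi, _, X.ι_map hj y⟩

/-- A relation between elements of a stage holds in the colimit only if it holds at some later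
stage. -/
theorem exists_relMap {n : ℕ} {ρ : Fin n → L.Sorts} (R : L.Rel n ρ) {j : J}
    (x : ∀ i, (X.obj j).Dom (ρ i)) (h : X.colim.relMap R (fun i => (X.ι j).toFun _ (x i))) :
    ∃ (k : J) (hk : j ≤ k), (X.obj k).relMap R (fun i => (X.map hk).toFun _ (x i)) := by
  obtain ⟨j', y, hxy, hy⟩ := h
  choose k hk hk' hkk using fun i => (X.mk_eq_iff _ _).1 (hxy i)
  obtain ⟨l, hl⟩ := Finite.exists_le k
  obtain ⟨m, hm, hm'⟩ := exists_ge_ge l j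
  obtain ⟨p, hp, hp'⟩ := exists_ge_ge m j'
  refine ⟨p, hm'.trans hp, ?_⟩
  convert (X.map hp').map_rel R y hy using 1
  funext i
  have := congrArg ((X.map ((hl i).trans (hm.trans hp))).toFun _) (hkk i)
  rwa [X.map_map, X.map_map] at this

theorem exists_locRel {s : L.Sorts} (d : L.Loc s) {j : J} (a b : (X.obj j).Dom s)
    (h : X.colim.locRel d ((X.ι j).toFun s a) ((X.ι j).toFun s b)) :
    ∃ (k : J) (hk : j ≤ k), (X.obj k).locRel d ((X.map hk).toFun s a) ((X.map hk).toFun s b) := by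
  unfold LStructure.locRel at h
  rw [← LHom.map_dpair (X.ι j).toFun a b] at h
  obtain ⟨k, hk, h⟩ := X.exists_relMap _ _ h
  rw [LHom.map_dpair (X.map hk).toFun a b] at h
  exact ⟨k, hk, h⟩

theorem exists_realize {α : Type} {σ : α → L.Sorts} (φ : PosForm L α σ) :
    ∀ {j : J} (v : ∀ a, (X.obj j).Dom (σ a)),
      φ.Realize X.colim (fun a => (X.ι j).toFun _ (v a)) →
      ∃ (k : J) (hk : j ≤ k), φ.Realize (X.obj k) (fun a => (X.map hk).toFun _ (v a)) := by
  induction φ with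
  | rel R ts =>
    intro j v h
    simp only [PosForm.Realize, LTerm.realize_map] at h ⊢
    exact X.exists_relMap R _ h
  | and φ ψ ihφ ihψ =>
    rintro j v ⟨h, h'⟩
    obtain ⟨k, hk, h⟩ := ihφ v h
    obtain ⟨l, hl, h'⟩ := ihψ (fun a => (X.map hk).toFun _ (v a)) (by simpa only [X.ι_map] using h')
    have h := h.map (X.map hl)
    simp only [X.map_map] at h h'
    exact ⟨l, hk.trans hl, h, h'⟩
  | or φ ψ ihφ ihψ =>
    rintro j v (h | h)
    · obtain ⟨k, hk, h⟩ := ihφ v h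
      exact ⟨k, hk, .inl h⟩
    · obtain ⟨k, hk, h⟩ := ihψ v h
      exact ⟨k, hk, .inr h⟩
  | ex s φ ih =>
    rintro j v ⟨x, hx⟩
    obtain ⟨k, hk, y, rfl⟩ := X.exists_ι_eq_of_le x j
    obtain ⟨l, hl, h⟩ := ih (vcons y (fun a => (X.map hk).toFun _ (v a))) (by
      rw [vcons_map]
      simpa only [X.ι_map] using hx)
    refine ⟨l, hk.trans hl, (X.map hl).toFun s y, ?_⟩
    rw [vcons_map] at h
    simpa only [X.map_map] using h

theorem localModel_colim {T : Set (PosSentence L)} (hX : ∀ j, LocalModel (X.obj j) T) :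
    LocalModel X.colim T where
  left :=
    { symm := fun {s} d a b h => by
        obtain ⟨j, a, rfl⟩ := X.exists_ι_eq a
        obtain ⟨k, hk, b, rfl⟩ := X.exists_ι_eq_of_le b j
        rw [← X.ι_map hk] at h ⊢
        obtain ⟨l, hl, h⟩ := X.exists_locRel d _ _ h
        have := (X.ι l).map_locRel d ((hX l).1.symm d _ _ h)
        simpa only [X.ι_map] using this
      mono := fun {s} d₁ d₂ hd a b h => by
        obtain ⟨j, a, rfl⟩ := X.exists_ι_eq a
        obtain ⟨k, hk, b, rfl⟩ := X.exists_ι_eq_of_le b j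
        rw [← X.ι_map hk] at h ⊢
        obtain ⟨l, hl, h⟩ := X.exists_locRel d₁ _ _ h
        have := (X.ι l).map_locRel d₂ ((hX l).1.mono d₁ d₂ hd _ _ h)
        simpa only [X.ι_map] using this
      comp := fun {s} d₁ d₂ a b c hab hbc => by
        obtain ⟨j, a, rfl⟩ := X.exists_ι_eq a
        obtain ⟨k, hk, b, rfl⟩ := X.exists_ι_eq_of_le b j
        obtain ⟨l, hl, c, rfl⟩ := X.exists_ι_eq_of_le c k
        rw [← X.ι_map hk] at hab
        obtain ⟨p, hp, hab⟩ := X.exists_locRel d₁ _ _ hab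
        rw [← X.ι_map hl] at hbc
        obtain ⟨q, hq, hbc⟩ := X.exists_locRel d₂ _ _ hbc
        obtain ⟨r, hpr, hqr⟩ := exists_ge_ge p q
        have hab := (X.map hpr).map_locRel d₁ hab
        have hbc := (X.map hqr).map_locRel d₂ hbc
        simp only [X.map_map] at hab hbc
        have := (X.ι r).map_locRel _ ((hX r).1.comp d₁ d₂ _ _ _ hab hbc)
        simpa only [X.ι_map] using this
      boundAx := fun {s} c₁ c₂ => by
        let j := Classical.arbitrary J
        rw [← (X.ι j).map_const, ← (X.ι j).map_const]
        exact (X.ι j).map_locRel _ ((hX j).1.boundAx c₁ c₂)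
      total := fun {s} a b => by
        obtain ⟨j, a, rfl⟩ := X.exists_ι_eq a
        obtain ⟨k, hk, b, rfl⟩ := X.exists_ι_eq_of_le b j
        rw [← X.ι_map hk]
        obtain ⟨d, hd⟩ := (hX k).1.total ((X.map hk).toFun s a) b
        exact ⟨d, (X.ι k).map_locRel d hd⟩
      dd0_eq := fun {s} a b => by
        obtain ⟨j, a, rfl⟩ := X.exists_ι_eq a
        obtain ⟨k, hk, b, rfl⟩ := X.exists_ι_eq_of_le b j
        rw [← X.ι_map hk]
        constructor
        · intro h
          obtain ⟨l, hl, h⟩ := X.exists_locRel _ _ _ h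
          rw [(hX l).1.dd0_eq] at h
          exact (X.ι_eq_iff _ _).2 ⟨l, hl, hl, h⟩
        · intro h
          obtain ⟨l, hl, _, h⟩ := (X.ι_eq_iff _ _).1 h
          rw [← (hX l).1.dd0_eq] at h
          simpa only [X.ι_map] using (X.ι l).map_locRel _ h }
  right φ hφ h := by
    let v : (e : Empty) → (X.obj (Classical.arbitrary J)).Dom (emptySorts L e) := fun e => e.elim
    obtain ⟨k, hk, h⟩ := X.exists_realize φ v ((PosSentence.realizedIn_iff _).1 h)
    exact (hX k).2 φ hφ ((PosSentence.realizedIn_iff _).2 h)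

/-- The homomorphism from the colimit induced by a compatible family. -/
def desc {N : LStructure L} (f : ∀ j, LHom (X.obj j) N)
    (hf : ∀ {i j : J} (h : i ≤ j) {s : L.Sorts} (x : (X.obj i).Dom s),
      (f j).toFun s ((X.map h).toFun s x) = (f i).toFun s x) : LHom X.colim N where
  toFun s := Quotient.lift (fun p => (f p.1).toFun s p.2) (by
    rintro p q ⟨k, hp, hq, h⟩
    simpa only [hf] using congrArg ((f k).toFun s) h)
  map_rel R x := by
    rintro ⟨j, y, hxy, hy⟩
    obtain rfl : x = _ := funext hxy
    exact (f j).map_rel R y hy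
  map_const c := (f _).map_const c

end LSystem

/-! ## Bounded reduced powers -/

section ReducedPower

variable {L : LocalLanguage} (B : LStructure L) {I : Type} (l : Filter I)

/-- The bounded part of the reduced power of `B` modulo the filter `l`: the germs staying at a
fixed distance from some element of `B`. -/
def LStructure.boundedPower (hB : IsLocal B) : LStructure L where
  Dom s := {x : l.Germ (B.Dom s) //
    ∃ (b : B.Dom s) (d : L.Loc s), ∀ᶠ i in l, B.locRel d (Quotient.out x i) b}
  relMap R x := ∀ᶠ i in l, B.relMap R (fun k => Quotient.out (x k).1 i)
  constMap {s} c := ⟨((fun _ => B.constMap c : I → B.Dom s) : l.Germ (B.Dom s)),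
    B.constMap c, L.dd0 s, by
      filter_upwards [Filter.Germ.coe_eq.1
        (Quotient.out_eq ((fun _ => B.constMap c : I → B.Dom s) : l.Germ (B.Dom s)))] with i hi
      rw [hi, hB.dd0_eq]⟩

variable {B l} (hB : IsLocal B)

/-- The element of the bounded power represented by a bounded family. -/
def LStructure.boundedPowerMk {s : L.Sorts} (x : I → B.Dom s)
    (h : ∃ (b : B.Dom s) (d : L.Loc s), ∀ᶠ i in l, B.locRel d (x i) b) :
    (B.boundedPower l hB).Dom s :=
  ⟨(x : l.Germ (B.Dom s)), by
    obtain ⟨b, d, h⟩ := h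
    refine ⟨b, d, ?_⟩
    filter_upwards [h, Filter.Germ.coe_eq.1 (Quotient.out_eq (x : l.Germ (B.Dom s)))] with i hi hi'
    rwa [hi']⟩

/-- A representative of an element of the bounded power. -/
def LStructure.boundedPowerRep {s : L.Sorts} (x : (B.boundedPower l hB).Dom s) : I → B.Dom s :=
  Quotient.out x.1

namespace LStructure

theorem boundedPowerRep_mk {s : L.Sorts} (x : I → B.Dom s)
    (h : ∃ (b : B.Dom s) (d : L.Loc s), ∀ᶠ i in l, B.locRel d (x i) b) :
    ∀ᶠ i in l, boundedPowerRep hB (boundedPowerMk hB x h) i = x i :=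
  Filter.Germ.coe_eq.1 (Quotient.out_eq (x : l.Germ (B.Dom s)))

theorem boundedPower_ext_iff {s : L.Sorts} {x y : (B.boundedPower l hB).Dom s} :
    x = y ↔ ∀ᶠ i in l, boundedPowerRep hB x i = boundedPowerRep hB y i := by
  have h (z : (B.boundedPower l hB).Dom s) :
      ((boundedPowerRep hB z : I → B.Dom s) : l.Germ (B.Dom s)) = z.1 := Quotient.out_eq z.1
  exact Subtype.ext_iff.trans
    ((iff_of_eq (congrArg₂ Eq (h x).symm (h y).symm)).trans Filter.Germ.coe_eq)

theorem exists_bound_boundedPowerRep {s : L.Sorts} (x : (B.boundedPower l hB).Dom s) :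
    ∃ (b : B.Dom s) (d : L.Loc s), ∀ᶠ i in l, B.locRel d (boundedPowerRep hB x i) b :=
  x.2

theorem boundedPower_relMap_iff {n : ℕ} {ρ : Fin n → L.Sorts} (R : L.Rel n ρ)
    (x : ∀ k, (B.boundedPower l hB).Dom (ρ k)) :
    (B.boundedPower l hB).relMap R x ↔
      ∀ᶠ i in l, B.relMap R (fun k => boundedPowerRep hB (x k) i) :=
  Iff.rfl

theorem boundedPower_relMap_of_mk {n : ℕ} {ρ : Fin n → L.Sorts} (R : L.Rel n ρ)
    (x : ∀ k, I → B.Dom (ρ k))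
    (h : ∀ k, ∃ (b : B.Dom (ρ k)) (d : L.Loc (ρ k)), ∀ᶠ i in l, B.locRel d (x k i) b)
    (hx : ∀ᶠ i in l, B.relMap R (fun k => x k i)) :
    (B.boundedPower l hB).relMap R (fun k => boundedPowerMk hB (x k) (h k)) := by
  rw [boundedPower_relMap_iff]
  filter_upwards [hx, Filter.eventually_all.2 fun k => boundedPowerRep_mk hB (x k) (h k)]
    with i hi hi'
  simpa only [hi'] using hi

theorem boundedPower_locRel_iff {s : L.Sorts} (d : L.Loc s) (x y : (B.boundedPower l hB).Dom s) :
    (B.boundedPower l hB).locRel d x y ↔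
      ∀ᶠ i in l, B.locRel d (boundedPowerRep hB x i) (boundedPowerRep hB y i) := by
  refine (boundedPower_relMap_iff hB _ _).trans
    (Filter.eventually_congr (.of_forall fun i => iff_of_eq ?_))
  exact congrArg (B.relMap (L.locToRel d))
    (LHom.map_dpair (M := B.boundedPower l hB) (N := B)
      (fun _ x => boundedPowerRep hB x i) x y)

theorem boundedPowerRep_constMap {s : L.Sorts} (c : L.Const s) :
    ∀ᶠ i in l, boundedPowerRep hB ((B.boundedPower l hB).constMap c) i = B.constMap c :=
  Filter.Germ.coe_eq.1
    (Quotient.out_eq ((fun _ => B.constMap c : I → B.Dom s) : l.Germ (B.Dom s)))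

theorem boundedPowerRep_realize_term {α : Type} {σ : α → L.Sorts} {s : L.Sorts}
    (v : ∀ a, (B.boundedPower l hB).Dom (σ a)) (t : LTerm L α σ s) :
    ∀ᶠ i in l, boundedPowerRep hB (t.realize (B.boundedPower l hB) v) i =
      t.realize B (fun a => boundedPowerRep hB (v a) i) := by
  cases t with
  | var a => exact .of_forall fun _ => rfl
  | const c => exact boundedPowerRep_constMap hB c

theorem eventually_realize_of_boundedPower {α : Type} {σ : α → L.Sorts} (φ : PosForm L α σ) :
    ∀ v : ∀ a, (B.boundedPower l hB).Dom (σ a), φ.Realize (B.boundedPower l hB) v →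
      ∀ᶠ i in l, φ.Realize B (fun a => boundedPowerRep hB (v a) i) := by
  induction φ with
  | rel R ts =>
    intro v h
    filter_upwards [(boundedPower_relMap_iff hB _ _).1 h,
      Filter.eventually_all.2 fun k => boundedPowerRep_realize_term hB v (ts k)] with i hi hi'
    simpa only [PosForm.Realize, hi'] using hi
  | and φ ψ ihφ ihψ => exact fun v h => (ihφ v h.1).and (ihψ v h.2)
  | or φ ψ ihφ ihψ =>
    rintro v (h | h)
    · exact (ihφ v h).mono fun _ => .inl
    · exact (ihψ v h).mono fun _ => .inr
  | ex s φ ih =>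
    rintro v ⟨x, hx⟩
    filter_upwards [ih _ hx] with i hi
    refine ⟨boundedPowerRep hB x i, ?_⟩
    rwa [vcons_map (M := B.boundedPower l hB) (N := B) (fun _ x => boundedPowerRep hB x i)] at hi

theorem localModel_boundedPower [l.NeBot] {T : Set (PosSentence L)} (hBT : LocalModel B T) :
    LocalModel (B.boundedPower l hBT.1) T where
  left :=
    { symm := fun d x y h => by
        rw [boundedPower_locRel_iff] at *
        exact h.mono fun i => hBT.1.symm d _ _
      mono := fun d₁ d₂ hd x y h => by
        rw [boundedPower_locRel_iff] at *
        exact h.mono fun i => hBT.1.mono d₁ d₂ hd _ _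
      comp := fun d₁ d₂ x y z h h' => by
        rw [boundedPower_locRel_iff] at *
        filter_upwards [h, h'] with i hi hi'
        exact hBT.1.comp d₁ d₂ _ _ _ hi hi'
      boundAx := fun c₁ c₂ => by
        rw [boundedPower_locRel_iff]
        filter_upwards [boundedPowerRep_constMap hBT.1 c₁, boundedPowerRep_constMap hBT.1 c₂]
          with i hi hi'
        rw [hi, hi']
        exact hBT.1.boundAx c₁ c₂
      total := fun x y => by
        obtain ⟨b, d, h⟩ := exists_bound_boundedPowerRep hBT.1 x
        obtain ⟨b', d', h'⟩ := exists_bound_boundedPowerRep hBT.1 y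
        obtain ⟨e, he⟩ := hBT.1.total b b'
        refine ⟨L.locMul (L.locMul d e) d', ?_⟩
        rw [boundedPower_locRel_iff]
        filter_upwards [h, h'] with i hi hi'
        exact hBT.1.comp _ _ _ _ _ (hBT.1.comp _ _ _ _ _ hi he) (hBT.1.symm _ _ _ hi')
      dd0_eq := fun x y => by
        rw [boundedPower_locRel_iff, boundedPower_ext_iff]
        simp only [hBT.1.dd0_eq] }
  right φ hφ h := by
    let v : (e : Empty) → (B.boundedPower l hBT.1).Dom (emptySorts L e) := fun e => e.elim
    obtain ⟨i, hi⟩ :=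
      (eventually_realize_of_boundedPower hBT.1 φ v ((PosSentence.realizedIn_iff v).1 h)).exists
    exact hBT.2 φ hφ ((PosSentence.realizedIn_iff _).2 hi)

theorem boundedPowerMk_eq {s : L.Sorts} {x y : I → B.Dom s}
    {hx : ∃ (b : B.Dom s) (d : L.Loc s), ∀ᶠ i in l, B.locRel d (x i) b}
    {hy : ∃ (b : B.Dom s) (d : L.Loc s), ∀ᶠ i in l, B.locRel d (y i) b}
    (h : ∀ᶠ i in l, x i = y i) : boundedPowerMk hB x hx = boundedPowerMk hB y hy :=
  Subtype.ext (Filter.Germ.coe_eq.2 h)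

theorem exists_bound_const (hB : IsLocal B) {s : L.Sorts} (b : B.Dom s) :
    ∃ (b' : B.Dom s) (d : L.Loc s), ∀ᶠ _ in l, B.locRel d b b' :=
  ⟨b, L.dd0 s, .of_forall fun _ => (hB.dd0_eq b b).2 rfl⟩

/-- The diagonal homomorphism into the bounded power. -/
def toBoundedPower : LHom B (B.boundedPower l hB) where
  toFun _ b := boundedPowerMk hB (fun _ => b) (exists_bound_const hB b)
  map_rel R x h := boundedPower_relMap_of_mk hB R (fun k _ => x k) _ (.of_forall fun _ => h)
  map_const _ := rfl

end LStructure

end ReducedPower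

/-! ## Amalgamation over positive embeddings -/

section Amalgamation

variable {L : LocalLanguage} {M : LStructure L}

theorem relMap_tpair {α : Type} {σ : α → L.Sorts} (v : ∀ a, M.Dom (σ a)) {s : L.Sorts}
    (d : L.Loc s) (t t' : LTerm L α σ s) :
    M.relMap (L.locToRel d) (fun i => (tpair t t' i).realize M v) ↔
      M.locRel d (t.realize M v) (t'.realize M v) := by
  refine iff_of_eq (congrArg (M.relMap (L.locToRel d)) ?_)
  funext i
  match i with
  | ⟨0, _⟩ => rfl
  | ⟨1, _⟩ => rfl

/-- A property of valuations in local structures is implied at `w` if it follows from finitely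
many positive formulas true of `w`. -/
def PosImplied {α : Type} {σ : α → L.Sorts} (w : ∀ a, M.Dom (σ a))
    (Θ : (B : LStructure L) → (∀ a, B.Dom (σ a)) → Prop) : Prop :=
  ∃ l : List (PosForm L α σ), (∀ φ ∈ l, φ.Realize M w) ∧
    ∀ (B : LStructure L), IsLocal B → ∀ u : ∀ a, B.Dom (σ a), (∀ φ ∈ l, φ.Realize B u) → Θ B u

namespace PosImplied

variable {α : Type} {σ : α → L.Sorts} {w : ∀ a, M.Dom (σ a)}
  {Θ Θ' : (B : LStructure L) → (∀ a, B.Dom (σ a)) → Prop}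

theorem and (h : PosImplied w Θ) (h' : PosImplied w Θ') :
    PosImplied w (fun B u => Θ B u ∧ Θ' B u) := by
  obtain ⟨l, hl, hΘ⟩ := h
  obtain ⟨l', hl', hΘ'⟩ := h'
  refine ⟨l ++ l', fun φ hφ => (List.mem_append.1 hφ).elim (hl φ) (hl' φ), fun B hB u hu =>
    ⟨hΘ B hB u fun φ hφ => hu φ (List.mem_append_left _ hφ),
      hΘ' B hB u fun φ hφ => hu φ (List.mem_append_right _ hφ)⟩⟩

theorem mono (h : PosImplied w Θ) (hΘ : ∀ B, IsLocal B → ∀ u, Θ B u → Θ' B u) :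
    PosImplied w Θ' := by
  obtain ⟨l, hl, h⟩ := h
  exact ⟨l, hl, fun B hB u hu => hΘ B hB u (h B hB u hu)⟩

theorem of_forall (h : ∀ B u, Θ B u) : PosImplied w Θ :=
  ⟨[], by simp, fun B _ u _ => h B u⟩

theorem forall_finite {ι : Type} [Finite ι]
    {Θ : ι → (B : LStructure L) → (∀ a, B.Dom (σ a)) → Prop}
    (h : ∀ i, PosImplied w (Θ i)) : PosImplied w (fun B u => ∀ i, Θ i B u) := by
  have := Fintype.ofFinite ι
  choose l hl hΘ using h
  refine ⟨Finset.univ.toList.flatMap l, ?_, fun B hB u hu i => hΘ i B hB u fun φ hφ => hu φ ?_⟩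
  · simpa using fun φ i hφ => hl i φ hφ
  · simpa using ⟨i, hφ⟩

theorem rel {n : ℕ} {ρ : Fin n → L.Sorts} (R : L.Rel n ρ) (ts : ∀ i, LTerm L α σ (ρ i))
    (h : M.relMap R (fun i => (ts i).realize M w)) :
    PosImplied w (fun B u => B.relMap R (fun i => (ts i).realize B u)) :=
  ⟨[.rel R ts], by simpa [PosForm.Realize] using h, fun B _ u hu => hu _ (List.mem_singleton.2 rfl)⟩

theorem termEq (hM : IsLocal M) {s : L.Sorts} {t t' : LTerm L α σ s}
    (h : t.realize M w = t'.realize M w) :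
    PosImplied w (fun B u => t.realize B u = t'.realize B u) :=
  (rel (L.locToRel (L.dd0 s)) (tpair t t')
    ((relMap_tpair _ _ _ _).2 ((hM.dd0_eq _ _).2 h))).mono
      fun _ hB _ hu => (hB.dd0_eq _ _).1 ((relMap_tpair _ _ _ _).1 hu)

theorem ex (hM : IsLocal M) {s : L.Sorts} (m : M.Dom s)
    {Θ : (B : LStructure L) → (∀ o, B.Dom (osort s σ o)) → Prop}
    (h : PosImplied (σ := osort s σ) (vcons m w) Θ) :
    PosImplied w (fun B u => ∃ x : B.Dom s, Θ B (vcons x u)) := by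
  obtain ⟨l, hl, hΘ⟩ := h
  let triv : PosForm L (Option α) (osort s σ) :=
    .rel (L.locToRel (L.dd0 s)) (tpair (s := s) (t := s) (.var none) (.var none))
  have htriv : triv.Realize M (vcons m w) := by
    have := (hM.dd0_eq m m).2 rfl
    simp only [triv, PosForm.Realize]
    exact (relMap_tpair _ _ _ _).2 this
  have key : ∀ (B : LStructure L) (v : ∀ o, B.Dom (osort s σ o)),
      (l.foldr .and triv).Realize B v ↔ (∀ φ ∈ l, φ.Realize B v) ∧ triv.Realize B v := by
    intro B v
    clear hl hΘ htriv
    induction l with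
    | nil => simp
    | cons φ l ih => simp [PosForm.Realize, ih, and_assoc]
  refine ⟨[.ex s (l.foldr .and triv)], ?_, fun B hB u hu => ?_⟩
  · simp only [List.mem_singleton, forall_eq]
    exact ⟨m, (key _ _).2 ⟨hl, htriv⟩⟩
  · obtain ⟨x, hx⟩ := hu _ (List.mem_singleton.2 rfl)
    exact ⟨x, hΘ B hB _ ((key _ _).1 hx).1⟩

end PosImplied

/-- An atomic fact: a relation symbol together with a tuple of elements. -/
abbrev AtomicFact (M : LStructure L) :=
  Σ (n : ℕ) (ρ : Fin n → L.Sorts) (_ : L.Rel n ρ), ∀ i, M.Dom (ρ i)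

/-- A fact about `M` is preserved by a family of maps. -/
def AtomicFact.MappedBy (F : AtomicFact M) {B : LStructure L}
    (b : ∀ s, M.Dom s → B.Dom s) : Prop :=
  B.relMap F.2.2.1 (fun i => b _ (F.2.2.2 i))

theorem exists_term_of_eq {α : Type} {σ : α → L.Sorts} (w : ∀ a, M.Dom (σ a)) {s : L.Sorts}
    (m : M.Dom s) (a : α) (h : (⟨σ a, w a⟩ : Σ s, M.Dom s) = ⟨s, m⟩) :
    ∃ t : LTerm L α σ s, t.realize M w = m ∧
      ∀ (B : LStructure L) (u : ∀ a, B.Dom (σ a)),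
        (⟨σ a, u a⟩ : Σ s, B.Dom s) = ⟨s, t.realize B u⟩ ∧
          ∀ b : ∀ s, M.Dom s → B.Dom s, (b _ (w a) = u a → b s m = t.realize B u) := by
  cases h
  exact ⟨.var a, rfl, fun _ _ => ⟨rfl, fun _ h => h⟩⟩

/-- Finitely many atomic facts about the values of `w` are implied at `w`. -/
theorem posImplied_exists_map_of_range (hM : IsLocal M) {α : Type} [Finite α] {σ : α → L.Sorts}
    (w : ∀ a, M.Dom (σ a)) {ι : Type} [Finite ι] (F : ι → AtomicFact M)
    (hF : ∀ j, M.relMap (F j).2.2.1 (F j).2.2.2)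
    (hw : ∀ j k, ∃ a, (⟨σ a, w a⟩ : Σ s, M.Dom s) = ⟨_, (F j).2.2.2 k⟩) :
    PosImplied w (fun B u => (∀ s, Nonempty (M.Dom s) → Nonempty (B.Dom s)) →
      ∃ b : ∀ s, M.Dom s → B.Dom s, (∀ j, (F j).MappedBy b) ∧ ∀ a, b _ (w a) = u a) := by
  have hrel : PosImplied w (fun B u => ∀ (j : ι) (b : ∀ s, M.Dom s → B.Dom s),
      (∀ a, b _ (w a) = u a) → (F j).MappedBy b) := by
    refine .forall_finite fun j => ?_
    choose a ha using hw j
    choose t ht htB using fun k => exists_term_of_eq w _ _ (ha k)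
    refine (PosImplied.rel (F j).2.2.1 t (by simpa only [ht] using hF j)).mono
      fun B _ u hu b hb => ?_
    simpa only [AtomicFact.MappedBy, fun k => (htB k B u).2 b (hb _)] using hu
  have heq : PosImplied w (fun B u => ∀ a a', (⟨σ a, w a⟩ : Σ s, M.Dom s) = ⟨σ a', w a'⟩ →
      (⟨σ a, u a⟩ : Σ s, B.Dom s) = ⟨σ a', u a'⟩) := by
    refine .forall_finite fun a => .forall_finite fun a' => ?_
    by_cases h : (⟨σ a, w a⟩ : Σ s, M.Dom s) = ⟨σ a', w a'⟩
    swap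
    · exact .of_forall fun _ _ h' => absurd h' h
    obtain ⟨t, ht, htB⟩ := exists_term_of_eq w _ a h
    refine (PosImplied.termEq hM (t' := .var a') ht).mono fun B _ u hu _ => ?_
    exact (htB B u).1.trans (congrArg (Sigma.mk (σ a')) hu)
  refine (hrel.and heq).mono fun B _ u ⟨hu, hu'⟩ hne => ?_
  have : ∀ s (m : M.Dom s), ∃ y : B.Dom s, ∀ a, (⟨σ a, w a⟩ : Σ s, M.Dom s) = ⟨s, m⟩ →
      (⟨σ a, u a⟩ : Σ s, B.Dom s) = ⟨s, y⟩ := by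
    intro s m
    by_cases h : ∃ a, (⟨σ a, w a⟩ : Σ s, M.Dom s) = ⟨s, m⟩
    · obtain ⟨a, ha⟩ := h
      cases ha
      exact ⟨u a, fun a' ha' => hu' a' a ha'⟩
    · exact ⟨(hne s ⟨m⟩).some, fun a ha => absurd ⟨a, ha⟩ h⟩
  choose b hb using this
  have hb' : ∀ a, b _ (w a) = u a := fun a => (eq_of_heq (Sigma.mk.inj (hb _ _ a rfl)).2).symm
  exact ⟨b, fun j => hu j b hb', hb'⟩

/-- Finitely many atomic facts about `M` whose elements lie in the list `m` or in the range of `w`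
are implied at `w`. -/
theorem posImplied_exists_map (hM : IsLocal M) {ι : Type} [Finite ι] (F : ι → AtomicFact M)
    (hF : ∀ j, M.relMap (F j).2.2.1 (F j).2.2.2) (m : List (Σ s, M.Dom s)) :
    ∀ {α : Type} [Finite α] {σ : α → L.Sorts} (w : ∀ a, M.Dom (σ a)),
      (∀ j k, (⟨_, (F j).2.2.2 k⟩ : Σ s, M.Dom s) ∈ m ∨
        ∃ a, (⟨σ a, w a⟩ : Σ s, M.Dom s) = ⟨_, (F j).2.2.2 k⟩) →
      PosImplied w (fun B u => (∀ s, Nonempty (M.Dom s) → Nonempty (B.Dom s)) →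
        ∃ b : ∀ s, M.Dom s → B.Dom s, (∀ j, (F j).MappedBy b) ∧ ∀ a, b _ (w a) = u a) := by
  induction m with
  | nil =>
    intro α _ σ w hw
    exact posImplied_exists_map_of_range hM w F hF fun j k => by simpa using hw j k
  | cons p m ih =>
    intro α _ σ w hw
    refine (PosImplied.ex hM p.2 (ih (vcons p.2 w) fun j k => ?_)).mono
      fun B _ u ⟨x, hx⟩ hne => ?_
    · rcases hw j k with h | ⟨a, ha⟩
      · rcases List.mem_cons.1 h with h | h
        · exact .inr ⟨none, h.symm⟩
        · exact .inl h
      · exact .inr ⟨some a, ha⟩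
    · obtain ⟨b, hb, hb'⟩ := hx hne
      exact ⟨b, hb, fun a => hb' (some a)⟩

theorem LHom.IsPosEmbedding.nonempty {A M : LStructure L} (hM : IsLocal M) {f : LHom A M}
    (hf : f.IsPosEmbedding) {s : L.Sorts} (h : Nonempty (M.Dom s)) : Nonempty (A.Dom s) := by
  obtain ⟨m⟩ := h
  let φ : PosForm L Empty (emptySorts L) :=
    .ex s (.rel (L.locToRel (L.dd0 s)) (tpair (s := s) (t := s) (.var none) (.var none)))
  have : φ.Realize A (fun e => e.elim) :=
    hf _ _ φ _ ⟨m, (relMap_tpair _ _ _ _).2 ((hM.dd0_eq _ _).2 rfl)⟩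
  exact ⟨this.choose⟩

/-- A positive embedding and a homomorphism with the same domain can be amalgamated on finite
parts. -/
theorem LHom.IsPosEmbedding.exists_map {A M B : LStructure L} (hM : IsLocal M) (hB : IsLocal B)
    {f : LHom A M} (hf : f.IsPosEmbedding) (g : LHom A B) (E : Finset (Σ s, A.Dom s))
    (F : Finset (AtomicFact M)) :
    ∃ b : ∀ s, M.Dom s → B.Dom s,
      (∀ j ∈ F, M.relMap j.2.2.1 j.2.2.2 → AtomicFact.MappedBy j b) ∧
        ∀ a ∈ E, b _ (f.toFun _ a.2) = g.toFun _ a.2 := by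
  let ι := {j : AtomicFact M // j ∈ F ∧ M.relMap j.2.2.1 j.2.2.2}
  have : Finite ι := Set.Finite.subset F.finite_toSet fun j hj => hj.1
  have := Fintype.ofFinite ι
  let m : List (Σ s, M.Dom s) := Finset.univ.toList.flatMap fun j : ι =>
    List.ofFn fun k => ⟨_, j.1.2.2.2 k⟩
  obtain ⟨l, hl, hlB⟩ := posImplied_exists_map hM (fun j : ι => j.1) (fun j => j.2.2) m
    (fun a : E => f.toFun _ a.1.2) fun j k => .inl <| List.mem_flatMap.2
      ⟨j, by simp, (List.mem_ofFn' _ _).2 ⟨k, rfl⟩⟩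
  obtain ⟨b, hb, hb'⟩ := hlB B hB (fun a => g.toFun _ a.1.2)
    (fun φ hφ => (hf _ _ φ (fun a => a.1.2) (hl φ hφ)).map g)
    fun s hs => (hf.nonempty hM hs).map (g.toFun s)
  exact ⟨b, fun j hj hj' => hb ⟨j, hj, hj'⟩, fun a ha => hb' ⟨a, ha⟩⟩

/-- A positive embedding and a homomorphism with the same domain can be amalgamated. -/
theorem LHom.IsPosEmbedding.exists_amalgam {T : Set (PosSentence L)} {A M B : LStructure L}
    (hM : LocalModel M T) (hB : LocalModel B T) {f : LHom A M}
    (hf : f.IsPosEmbedding) (g : LHom A B) :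
    ∃ C : LStructure L, LocalModel C T ∧ ∃ (k : LHom M C) (h : LHom B C), h.comp g = k.comp f := by
  classical
  let I := Finset (Σ s, A.Dom s) × Finset (AtomicFact M)
  let l : Filter I := Filter.atTop
  have : l.NeBot := Filter.atTop_neBot
  choose b hbF hbE using fun i : I => hf.exists_map hM.1 hB.1 g i.1 i.2
  have hF (j : AtomicFact M) (hj : M.relMap j.2.2.1 j.2.2.2) : ∀ᶠ i in l, j.MappedBy (b i) := by
    filter_upwards [Filter.eventually_ge_atTop ((∅, {j}) : I)] with i hi
    exact hbF i j (hi.2 (Finset.mem_singleton_self j)) hj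
  have hE {s : L.Sorts} (a : A.Dom s) : ∀ᶠ i in l, b i s (f.toFun s a) = g.toFun s a := by
    filter_upwards [Filter.eventually_ge_atTop (({⟨s, a⟩}, ∅) : I)] with i hi
    exact hbE i ⟨s, a⟩ (hi.1 (Finset.mem_singleton_self _))
  have hbd {s : L.Sorts} (m : M.Dom s) :
      ∃ (c : B.Dom s) (d : L.Loc s), ∀ᶠ i in l, B.locRel d (b i s m) c := by
    obtain ⟨a⟩ := hf.nonempty hM.1 ⟨m⟩
    obtain ⟨d, hd⟩ := hM.1.total m (f.toFun s a)
    refine ⟨g.toFun s a, d, ?_⟩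
    filter_upwards [hF ⟨2, _, L.locToRel d, dpair m (f.toFun s a)⟩ hd, hE a] with i hi hi'
    have := (congrArg (B.relMap (L.locToRel d)) (LHom.map_dpair (b i) m (f.toFun s a))).mp hi
    rwa [hi'] at this
  let k : LHom M (B.boundedPower l hB.1) :=
    { toFun := fun s m => LStructure.boundedPowerMk hB.1 (fun i => b i s m) (hbd m)
      map_rel := fun R x h =>
        LStructure.boundedPower_relMap_of_mk hB.1 R (fun k i => b i _ (x k)) _ (hF ⟨_, _, R, x⟩ h)
      map_const := fun {s} c => LStructure.boundedPowerMk_eq hB.1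
        (hy := LStructure.exists_bound_const hB.1 (B.constMap c)) <| by
          filter_upwards [hE (A.constMap c)] with i hi
          rwa [f.map_const, g.map_const] at hi }
  refine ⟨_, LStructure.localModel_boundedPower hB, k, LStructure.toBoundedPower hB.1, ?_⟩
  refine LHom.ext fun s a => ?_
  refine LStructure.boundedPowerMk_eq (l := l) hB.1
    (hx := LStructure.exists_bound_const hB.1 (g.toFun s a)) (hy := hbd (f.toFun s a)) ?_
  filter_upwards [hE a] with i hi using hi.symm

end Amalgamation

section Iteration

/-! ## Transfinite iteration in categories of local models -/

open CategoryTheory Limits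

/-- A local model of `T` with a family of distinguished points. -/
structure PointedModel {L : LocalLanguage} (T : Set (PosSentence L)) (K : L.Sorts → Type) :
    Type 1 where
  str : LStructure L
  isModel : LocalModel str T
  pt : ∀ s, K s → str.Dom s

namespace PointedModel

variable {L : LocalLanguage} {T : Set (PosSentence L)} {K : L.Sorts → Type}

instance : Category.{0} (PointedModel T K) where
  Hom X Y := {h : LHom X.str Y.str // ∀ s c, h.toFun s (X.pt s c) = Y.pt s c}
  id X := ⟨LHom.id X.str, fun _ _ => rfl⟩
  comp f g := ⟨g.1.comp f.1, fun s c => by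
    rw [← g.2, ← f.2]
    rfl⟩

variable {J : Type} [Preorder J] [IsDirectedOrder J] [Nonempty J]

/-- The directed system of structures underlying a diagram of pointed models. -/
def system (F : J ⥤ PointedModel T K) : LSystem L J where
  obj j := (F.obj j).str
  map h := (F.map (homOfLE h)).1
  map_refl {i s} x := LHom.congr_toFun (congrArg Subtype.val (F.map_id i)) s x
  map_map {_ _ _} hij hjk {s} x :=
    (LHom.congr_toFun (congrArg Subtype.val (F.map_comp (homOfLE hij) (homOfLE hjk))) s x).symm

/-- The colimit of a directed diagram of pointed models. -/
def colimitCocone (F : J ⥤ PointedModel T K) : Cocone F where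
  pt :=
    { str := (system F).colim
      isModel := (system F).localModel_colim fun j => (F.obj j).isModel
      pt := fun s c => ((system F).ι (Classical.arbitrary J)).toFun s ((F.obj _).pt s c) }
  ι :=
    { app := fun j => ⟨(system F).ι j, fun s c => by
        obtain ⟨k, hj, hk⟩ := exists_ge_ge j (Classical.arbitrary J)
        refine ((system F).ι_eq_iff _ _).2 ⟨k, hj, hk, ?_⟩
        exact ((F.map (homOfLE hj)).2 s c).trans ((F.map (homOfLE hk)).2 s c).symm⟩
      naturality := fun i j f => Subtype.ext <| LHom.ext fun s x => (system F).ι_map f.le x }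

def isColimitColimitCocone (F : J ⥤ PointedModel T K) : IsColimit (colimitCocone F) where
  desc c := ⟨(system F).desc (fun j => (c.ι.app j).1) fun {_ _} h {s} x =>
      LHom.congr_toFun (congrArg Subtype.val (c.w (homOfLE h))) s x,
    fun s x => (c.ι.app _).2 s x⟩
  fac c j := rfl
  uniq c m hm := Subtype.ext <| LHom.ext fun s x => by
    obtain ⟨j, y, rfl⟩ := (system F).exists_ι_eq x
    exact LHom.congr_toFun (congrArg Subtype.val (hm j)) s y

instance : HasColimitsOfShape J (PointedModel T K) where
  has_colimit F := ⟨⟨⟨_, isColimitColimitCocone F⟩⟩⟩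

theorem hasIterationOfShape (J : Type) [LinearOrder J] [Nonempty J] :
    HasIterationOfShape J (PointedModel T K) where
  hasColimitsOfShape_of_isSuccLimit j hj := by
    have : Nonempty (Set.Iio j) := hj.nonempty_Iio.to_subtype
    infer_instance

end PointedModel

/-- In a category with transfinite iterations, every object maps to one that satisfies all the
conditions, from a given small family, which are satisfied further along. -/
theorem exists_saturated {C : Type 1} [Category.{0} C]
    (hC : ∀ (J : Type) [LinearOrder J] [Nonempty J], HasIterationOfShape J C) {O : Type}
    (P : O → C → Prop) (hP : ∀ o {X Y : C}, (X ⟶ Y) → P o X → P o Y) (X₀ : C) :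
    ∃ X : C, Nonempty (X₀ ⟶ X) ∧ ∀ o Y, (X ⟶ Y) → P o Y → P o X := by
  by_contra! hX
  have hsucc (X : C) : ∃ (Y : C) (_ : X ⟶ Y), Nonempty (X₀ ⟶ X) → ∃ o, P o Y ∧ ¬ P o X := by
    by_cases h : Nonempty (X₀ ⟶ X)
    · obtain ⟨o, Y, f, hY, hX⟩ := hX X h
      exact ⟨Y, f, fun _ => ⟨o, hY, hX⟩⟩
    · exact ⟨X, 𝟙 X, fun h' => absurd h' h⟩
  choose succ toSucc hsucc using hsucc
  let Φ : SmallObject.SuccStruct C := ⟨X₀, succ, toSucc⟩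
  let c := Order.succ (max Cardinal.aleph0 (Cardinal.mk O))
  have hc : Cardinal.aleph0 ≤ c := (le_max_left _ _).trans (Order.le_succ _)
  let J := c.ord.ToType
  have : NoMaxOrder J := Cardinal.noMaxOrder hc
  have : Nonempty J := Cardinal.mk_ne_zero_iff.1 (by
    rw [Cardinal.mk_ord_toType]
    exact (Cardinal.aleph0_pos.trans_le hc).ne')
  let : OrderBot J := WellFoundedLT.toOrderBot J
  have := hC J
  let F := Φ.iterationFunctor J
  choose o ho ho' using fun j : J => hsucc (F.obj j) ⟨(Φ.ιIterationFunctor J).app j⟩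
  have hlt {i j : J} (hij : i < j) : P (o i) (F.obj j) :=
    hP _ ((Φ.iterationFunctorObjSuccIso i (not_isMax i)).inv ≫
      F.map (homOfLE (Order.succ_le_of_lt hij))) (ho i)
  have hinj : Function.Injective o := fun i j hij => by
    by_contra hne
    rcases lt_or_gt_of_ne hne with h | h
    · exact ho' j (hij ▸ hlt h)
    · exact ho' i (hij ▸ hlt h)
  have := Cardinal.mk_le_of_injective hinj
  rw [Cardinal.mk_ord_toType] at this
  exact (((le_max_right _ _).trans_lt (Order.lt_succ _)).trans_le this).false

/-! ## Existentially closed models -/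

/-- A structure carried by subsets of `Ω`, together with a partial correspondence with a family
of points. -/
structure PointedExtension (L : LocalLanguage) (K : L.Sorts → Type) (Ω : Type) where
  dom : L.Sorts → Set Ω
  relMap : {n : ℕ} → {ρ : Fin n → L.Sorts} → L.Rel n ρ → ((i : Fin n) → dom (ρ i)) → Prop
  constMap : {s : L.Sorts} → L.Const s → dom s
  graph : (s : L.Sorts) → dom s → K s → Prop

def PointedExtension.toStruct {L : LocalLanguage} {K : L.Sorts → Type} {Ω : Type}
    (E : PointedExtension L K Ω) : LStructure L where
  Dom s := E.dom s
  relMap := E.relMap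
  constMap := E.constMap

/-- Every local model maps to one in which all small extension problems over the former that are
solvable further along are already solved. -/
theorem exists_extension_closed {L : LocalLanguage} {T : Set (PosSentence L)} (c : Cardinal)
    {M : LStructure L} (hM : LocalModel M T) :
    ∃ (M' : LStructure L) (i : LHom M M'), LocalModel M' T ∧
      ∀ B : LStructure L, B.card ≤ c → ∀ (G : ∀ s, B.Dom s → M.Dom s → Prop) (C : LStructure L),
        LocalModel C T → ∀ (k : LHom M' C) (h : LHom B C),
          (∀ s b m, G s b m → h.toFun s b = k.toFun s (i.toFun s m)) →
            ∃ h' : LHom B M', ∀ s b m, G s b m → h'.toFun s b = i.toFun s m := by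
  let P (E : PointedExtension L M.Dom c.out) (X : PointedModel T M.Dom) : Prop :=
    ∃ h : LHom E.toStruct X.str, ∀ s b m, E.graph s b m → h.toFun s b = X.pt s m
  obtain ⟨X, ⟨f⟩, hX⟩ := exists_saturated PointedModel.hasIterationOfShape P
    (fun E X Y k ⟨h, hh⟩ => ⟨k.1.comp h, fun s b m hG => by
      rw [← k.2, ← hh s b m hG]
      rfl⟩) ⟨M, hM, fun _ m => m⟩
  refine ⟨X.str, f.1, X.isModel, fun B hB G C hC k h hG => ?_⟩
  have hf (s) (m : M.Dom s) : f.1.toFun s m = X.pt s m := f.2 s m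
  simp only [hf] at hG ⊢
  rw [← Cardinal.mk_out c, LStructure.card, Cardinal.le_def] at hB
  obtain ⟨j⟩ := hB
  let e (s : L.Sorts) : B.Dom s ≃ Set.range fun b : B.Dom s => j ⟨s, b⟩ :=
    Equiv.ofInjective _ (j.injective.comp sigma_mk_injective)
  let E : PointedExtension L M.Dom c.out :=
    { dom := fun s => Set.range fun b : B.Dom s => j ⟨s, b⟩
      relMap := (B.transport e).relMap
      constMap := (B.transport e).constMap
      graph := fun s b m => G s ((e s).symm b) m }
  obtain ⟨h', hh'⟩ := hX E ⟨C, hC, fun s m => k.toFun s (X.pt s m)⟩ ⟨k, fun _ _ => rfl⟩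
    ⟨h.comp (B.ofTransport e), fun s b m hb => hG s _ m hb⟩
  refine ⟨LHom.comp (N := B.transport e) h' (B.toTransport e), fun s b m hb => ?_⟩
  exact hh' s (e s b) m (by simpa only [E, Equiv.symm_apply_apply] using hb)

/-- A structure is `c`-closed for `T` if every extension problem of size less than `c` over it
which has a solution in a local model further along has a solution in the structure itself. -/
def IsExtensionClosed {L : LocalLanguage} (T : Set (PosSentence L)) (M : LStructure L)
    (c : Cardinal) : Prop :=
  ∀ B : LStructure L, B.card < c → ∀ (ι : Type) (σ : ι → L.Sorts), Cardinal.mk ι < c →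
    ∀ (g : ∀ a, B.Dom (σ a)) (f : ∀ a, M.Dom (σ a)) (C : LStructure L), LocalModel C T →
      ∀ (k : LHom M C) (h : LHom B C), (∀ a, h.toFun _ (g a) = k.toFun _ (f a)) →
        ∃ h' : LHom B M, ∀ a, h'.toFun _ (g a) = f a

theorem exists_isExtensionClosed {L : LocalLanguage} {T : Set (PosSentence L)} {c : Cardinal}
    (hc : c.IsRegular) {N : LStructure L} (hN : LocalModel N T) :
    ∃ M : LStructure L, LocalModel M T ∧ Nonempty (LHom N M) ∧ IsExtensionClosed T M c := by
  choose M' i hM' hi using fun X : PointedModel T fun _ => Empty =>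
    exists_extension_closed c X.isModel
  let Φ : SmallObject.SuccStruct (PointedModel T fun _ => Empty) :=
    { X₀ := ⟨N, hN, fun _ x => x.elim⟩
      succ := fun X => ⟨M' X, hM' X, fun _ x => x.elim⟩
      toSucc := fun X => ⟨i X, fun _ x => x.elim⟩ }
  have : Fact c.IsRegular := ⟨hc⟩
  let J := c.ord.ToType
  have : NoMaxOrder J := Cardinal.noMaxOrder hc.aleph0_le
  have : Nonempty J := Cardinal.mk_ne_zero_iff.1 (by
    rw [Cardinal.mk_ord_toType]
    exact hc.pos.ne')
  let : OrderBot J := WellFoundedLT.toOrderBot J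
  have : HasIterationOfShape J (PointedModel T fun _ => Empty) :=
    PointedModel.hasIterationOfShape J
  let F := Φ.iterationFunctor J
  let S := PointedModel.system F
  refine ⟨S.colim, S.localModel_colim fun j => (F.obj j).isModel,
    ⟨(S.ι ⊥).comp ((Φ.ιIterationFunctor J).app ⊥).1⟩, ?_⟩
  intro B hB ι σ hι g f C hC k h hkh
  choose j x hx using fun a => S.exists_ι_eq (f a)
  let j₀ := IsCardinalFiltered.max j (by rwa [hasCardinalLT_iff_cardinal_mk_lt])
  have hj (a : ι) : j a ≤ j₀ := (IsCardinalFiltered.toMax j _ a).le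
  let y (a : ι) : (S.obj j₀).Dom (σ a) := (S.map (hj a)).toFun _ (x a)
  have hy (a : ι) : (S.ι j₀).toFun _ (y a) = f a := (S.ι_map _ _).trans (hx a)
  let e := Φ.iterationFunctorObjSuccIso j₀ (not_isMax j₀)
  have he : F.map (homOfLE (Order.le_succ j₀)) = Φ.toSucc (F.obj j₀) ≫ e.inv :=
    Φ.iterationFunctor_map_succ j₀ (not_isMax j₀)
  let l : LHom (M' (F.obj j₀)) S.colim := (S.ι (Order.succ j₀)).comp e.inv.1
  have hl {s : L.Sorts} (z : (S.obj j₀).Dom s) :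
      l.toFun s ((i (F.obj j₀)).toFun s z) = (S.ι j₀).toFun s z := by
    rw [← S.ι_map (Order.le_succ j₀)]
    exact congrArg ((S.ι (Order.succ j₀)).toFun s) (LHom.congr_toFun (congrArg Subtype.val he) s z).symm
  obtain ⟨h', hh'⟩ := hi (F.obj j₀) B hB.le
    (fun s b m => (⟨s, b, m⟩ : Σ s, B.Dom s × (S.obj j₀).Dom s) ∈
      Set.range fun a => ⟨σ a, g a, y a⟩) C hC (k.comp l) h (by
    rintro s b m ⟨a, ha⟩
    cases ha
    rw [hkh, ← hy, ← hl]
    rfl)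
  refine ⟨l.comp h', fun a => ?_⟩
  rw [← hy, ← hl, ← hh' _ (g a) (y a) ⟨a, rfl⟩]
  rfl

end Iteration

theorem LTerm.exists_finite_support {L : LocalLanguage} {N : LStructure L} {α : Type}
    {σ : α → L.Sorts} (v : ∀ a, N.Dom (σ a)) {s : L.Sorts} (t : LTerm L α σ s) :
    ∃ F : Set α, F.Finite ∧ ∀ (B : Substruct N) (hF : ∀ a ∈ F, v a ∈ B.carrier (σ a))
      (M : LStructure L) (k : LHom B.toStruct M) (u : ∀ a, M.Dom (σ a)),
        (∀ a (ha : a ∈ F), k.toFun _ ⟨v a, hF a ha⟩ = u a) →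
          ∃ h : t.realize N v ∈ B.carrier s, k.toFun s ⟨_, h⟩ = t.realize M u := by
  cases t with
  | var a => exact ⟨{a}, Set.finite_singleton a, fun B hF M k u hu => ⟨hF a rfl, hu a rfl⟩⟩
  | const c => exact ⟨∅, Set.finite_empty, fun B _ M k u _ => ⟨B.const_mem c, k.map_const c⟩⟩

/-- A positive formula which holds in a structure holds in the image of every substructure
containing suitable finitely many elements. -/
theorem PosForm.Realize.exists_finite_witness {L : LocalLanguage} {N : LStructure L} {α : Type}
    {σ : α → L.Sorts} (φ : PosForm L α σ) :
    ∀ {v : ∀ a, N.Dom (σ a)}, φ.Realize N v →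
      ∃ (F : Set α) (W : Set (Σ s, N.Dom s)), F.Finite ∧ W.Finite ∧
        ∀ (B : Substruct N), (∀ w ∈ W, w.2 ∈ B.carrier w.1) →
          ∀ hF : ∀ a ∈ F, v a ∈ B.carrier (σ a),
            ∀ (M : LStructure L) (k : LHom B.toStruct M) (u : ∀ a, M.Dom (σ a)),
              (∀ a (ha : a ∈ F), k.toFun _ ⟨v a, hF a ha⟩ = u a) → φ.Realize M u := by
  induction φ with
  | rel R ts =>
    intro v hv
    choose F hF H using fun i => (ts i).exists_finite_support v
    refine ⟨⋃ i, F i, ∅, Set.finite_iUnion hF, Set.finite_empty, fun B _ hB M k u hu => ?_⟩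
    choose h hh using fun i => H i B (fun a ha => hB a (Set.mem_iUnion_of_mem i ha)) M k u
      fun a ha => hu a (Set.mem_iUnion_of_mem i ha)
    have := k.map_rel R (fun i => ⟨_, h i⟩) hv
    simpa only [hh] using! this
  | and φ ψ ihφ ihψ =>
    rintro v ⟨h, h'⟩
    obtain ⟨F, W, hF, hW, H⟩ := ihφ h
    obtain ⟨F', W', hF', hW', H'⟩ := ihψ h'
    exact ⟨F ∪ F', W ∪ W', hF.union hF', hW.union hW', fun B hB hv M k u hu =>
      ⟨H B (fun w hw => hB w (.inl hw)) (fun a ha => hv a (.inl ha)) M k u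
        fun a ha => hu a (.inl ha),
      H' B (fun w hw => hB w (.inr hw)) (fun a ha => hv a (.inr ha)) M k u
        fun a ha => hu a (.inr ha)⟩⟩
  | or φ ψ ihφ ihψ =>
    rintro v (h | h)
    · obtain ⟨F, W, hF, hW, H⟩ := ihφ h
      exact ⟨F, W, hF, hW, fun B hB hv M k u hu => .inl (H B hB hv M k u hu)⟩
    · obtain ⟨F, W, hF, hW, H⟩ := ihψ h
      exact ⟨F, W, hF, hW, fun B hB hv M k u hu => .inr (H B hB hv M k u hu)⟩
  | @ex α σ s φ ih =>
    rintro v ⟨x, hx⟩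
    obtain ⟨F, W, hF, hW, H⟩ := ih hx
    refine ⟨some ⁻¹' F, insert ⟨s, x⟩ W, hF.preimage (Option.some_injective _).injOn,
      hW.insert _, fun B hB hv M k u hu => ?_⟩
    have hxB : x ∈ B.carrier s := hB ⟨s, x⟩ (Set.mem_insert _ _)
    refine ⟨k.toFun s ⟨x, hxB⟩, H B (fun w hw => hB w (Set.mem_insert_of_mem _ hw)) ?_ M k _ ?_⟩
    · rintro (_ | a) ha
      · exact hxB
      · exact hv a ha
    · rintro (_ | a) ha
      · rfl
      · exact hu a ha

/-- The substructure on a set of elements together with the constants. -/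
def LStructure.generate {L : LocalLanguage} (N : LStructure L) (W : Set (Σ s, N.Dom s)) :
    Substruct N where
  carrier s := {x | ⟨s, x⟩ ∈ W ∨ x ∈ Set.range (N.constMap (s := s))}
  const_mem c := .inr ⟨c, rfl⟩

theorem LStructure.card_generate_le {L : LocalLanguage} (N : LStructure L)
    (W : Set (Σ s, N.Dom s)) :
    (N.generate W).toStruct.card ≤ Cardinal.mk W + Cardinal.mk (Σ s, L.Const s) := by
  let f : W ⊕ (Σ s, L.Const s) → Σ s, (N.generate W).toStruct.Dom s :=
    Sum.elim (fun w => ⟨w.1.1, w.1.2, .inl w.2⟩) fun c => ⟨c.1, N.constMap c.2, .inr ⟨c.2, rfl⟩⟩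
  rw [Cardinal.add_def]
  refine Cardinal.mk_le_of_surjective (f := f) ?_
  rintro ⟨s, x, hx | ⟨c, rfl⟩⟩
  · exact ⟨.inl ⟨⟨s, x⟩, hx⟩, rfl⟩
  · exact ⟨.inr ⟨s, c⟩, rfl⟩

theorem IsExtensionClosed.isPC {L : LocalLanguage} {T : Set (PosSentence L)} {M : LStructure L}
    {c : Cardinal} (hM : LocalModel M T) (hc : Cardinal.aleph0 ≤ c)
    (hLc : Cardinal.mk (Σ s, L.Const s) < c) (h : IsExtensionClosed T M c) : IsPC M T := by
  refine ⟨hM, fun N k hN α σ φ v hφ => ?_⟩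
  obtain ⟨F, W, hF, hW, H⟩ := PosForm.Realize.exists_finite_witness φ hφ
  let W' : Set (Σ s, N.Dom s) := W ∪ (fun a => ⟨σ a, k.toFun _ (v a)⟩) '' F
  have hW' : W'.Finite := hW.union (hF.image _)
  let B := N.generate W'
  have hFB (a) (ha : a ∈ F) : k.toFun _ (v a) ∈ B.carrier (σ a) :=
    .inl (.inr ⟨a, ha, rfl⟩)
  obtain ⟨h', hh'⟩ := h B.toStruct
    ((N.card_generate_le W').trans_lt (Cardinal.add_lt_of_lt hc
      ((Cardinal.lt_aleph0_iff_set_finite.2 hW').trans_le hc) hLc))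
    F (fun a => σ a) ((Cardinal.lt_aleph0_iff_set_finite.2 hF).trans_le hc)
    (fun a => ⟨_, hFB a a.2⟩) (fun a => v a) N hN k B.incl fun _ => rfl
  exact H B (fun w hw => .inl (.inl hw)) hFB M h' v fun a ha => hh' ⟨a, ha⟩

theorem IsExtensionClosed.isUltrahomogeneous {L : LocalLanguage} {T : Set (PosSentence L)}
    {M : LStructure L} {c : Cardinal} (hM : LocalModel M T) (h : IsExtensionClosed T M c) :
    IsUltrahomogeneous T M c := by
  intro A B _ hB hAc hBc f hf g
  obtain ⟨C, hC, k, l, hkl⟩ := hf.exists_amalgam hM hB g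
  obtain ⟨h', hh'⟩ := h B hBc (Σ s, A.Dom s) Sigma.fst hAc (fun a => g.toFun _ a.2)
    (fun a => f.toFun _ a.2) C hC k l fun a => LHom.congr_toFun hkl _ _
  exact ⟨h', LHom.ext fun s x => hh' ⟨s, x⟩⟩

theorem IsUltrahomogeneous.mono {L : LocalLanguage} {T : Set (PosSentence L)}
    {M : LStructure L} {c c' : Cardinal} (h : IsUltrahomogeneous T M c') (hc : c ≤ c') :
    IsUltrahomogeneous T M c :=
  fun A B hA hB hAc hBc => h A B hA hB (hAc.trans_le hc) (hBc.trans_le hc)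

/-- For every local model `N` of `T` and every cardinal `κ`, there is a
homomorphism from `N` to a κ-ultrahomogeneous local positively closed model of `T`. -/
theorem hom_to_ultrahomogeneous
    {L : LocalLanguage} (T : Set (PosSentence L))
    (hT : IsNegLocalTheory T) (hsat : LocSat T) (κ : Cardinal)
    (N : LStructure L) (hN : LocalModel N T) :
    ∃ M : LStructure L, IsPC M T ∧ IsUltrahomogeneous T M κ ∧ Nonempty (LHom N M) := by
  let b := max Cardinal.aleph0 (max κ (Cardinal.mk (Σ s, L.Const s)))
  have hb : Cardinal.aleph0 ≤ b := le_max_left _ _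
  have hlt : b < Order.succ b := Order.lt_succ b
  obtain ⟨M, hM, hNM, h⟩ := exists_isExtensionClosed (Cardinal.isRegular_succ hb) hN
  refine ⟨M, h.isPC hM (hb.trans hlt.le) (lt_of_le_of_lt ?_ hlt),
    (h.isUltrahomogeneous hM).mono (le_trans ?_ hlt.le), hNM⟩
  · exact (le_max_right _ _).trans (le_max_right _ _)
  · exact (le_max_left _ _).trans (le_max_right _ _)
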